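/- Let G be a finite group with G = O^{2'}(G) (G has no proper normal subgroup of odd index) whose prime graph on real class sizes is disconnected with components π₁ and π₂ where 2 ∉ π₂. Then π₁ = {2} and π₂ = π(|i^G|) for some non-central involution i ∈ G. In particular, every real class size of G is either odd or a power of 2. -/

import Mathlib

/-- An element `x` of a group is *real* if it is conjugate to its inverse. -/
def IsRealEl (G : Type*) [Group G] (x : G) : Prop := ∃ g : G, g⁻¹ * x * g = x⁻¹

/-- The size of the conjugacy class of `x` in `G`. -/
noncomputable def clSize (G : Type*) [Group G] (x : G) : ℕ := Nat.card {y : G // IsConj x y}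

/-- Vertices of the prime graph on real class sizes. -/
def realVerts (G : Type*) [Group G] : Set ℕ :=
  {p | p.Prime ∧ ∃ x : G, IsRealEl G x ∧ p ∣ clSize G x}

/-- Adjacency in the prime graph on real class sizes. -/
def realAdj (G : Type*) [Group G] (p q : ℕ) : Prop :=
  p.Prime ∧ q.Prime ∧ p ≠ q ∧ ∃ x : G, IsRealEl G x ∧ p * q ∣ clSize G x

/-- The prime graph on real class sizes is disconnected. -/
def realDisconnected (G : Type*) [Group G] : Prop :=
  ∃ π₁ π₂ : Set ℕ, π₁.Nonempty ∧ π₂.Nonempty ∧ Disjoint π₁ π₂ ∧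
    π₁ ∪ π₂ = realVerts G ∧ ∀ p ∈ π₁, ∀ q ∈ π₂, ¬ realAdj G p q

section Tools

variable {G : Type*} [Group G]

theorem exists_pow_two_pow_odd_orderOf [Finite G] (g : G) : ∃ k : ℕ, Odd (orderOf (g ^ 2 ^ k)) := by
  obtain ⟨k, m, hm, h⟩ := Nat.exists_eq_two_pow_mul_odd (n := orderOf g) (orderOf_pos g).ne'
  refine ⟨k, ?_⟩
  rw [orderOf_pow, h, Nat.gcd_eq_right (Dvd.intro _ rfl), Nat.mul_div_cancel_left _ (by positivity)]
  exact hm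

theorem odd_pow_two_pow_eq_one {g : G} (h : Odd (orderOf g)) {k : ℕ} (hk : g ^ 2 ^ k = 1) :
    g = 1 := by
  rw [← orderOf_eq_one_iff]
  exact Nat.Coprime.eq_one_of_dvd ((Nat.coprime_two_right.2 h).pow_right k)
    (orderOf_dvd_of_pow_eq_one hk)

theorem odd_orderOf_pow {g : G} (h : Odd (orderOf g)) (n : ℕ) : Odd (orderOf (g ^ n)) :=
  Odd.of_dvd_nat h (orderOf_pow_dvd n)

theorem isPGroup_closure_pair {a b : G} (ha : a * a = 1) (hb : b * b = 1) {k : ℕ}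
    (hk : (a * b) ^ 2 ^ k = 1) : IsPGroup 2 (Subgroup.closure {a, b}) := by
  have ha' : a⁻¹ = a := inv_eq_of_mul_eq_one_left ha
  have hb' : b⁻¹ = b := inv_eq_of_mul_eq_one_left hb
  have hinv : a * (a * b) * a⁻¹ = (a * b)⁻¹ := by
    rw [mul_inv_rev, ha', hb']; rw [← mul_assoc, ha, one_mul]
  have hz : ∀ n : ℤ, a * (a * b) ^ n = (a * b) ^ (-n) * a := by
    intro n
    have := conj_zpow (a := a) (b := a * b) (i := n)
    rw [hinv, inv_zpow'] at this
    rw [this]; group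
  have key : ∀ g ∈ Subgroup.closure {a, b}, ∃ n : ℤ, g = (a * b) ^ n ∨ g = (a * b) ^ n * a := by
    intro g hg
    induction hg using Subgroup.closure_induction with
    | mem x hx =>
      rcases hx with rfl | rfl
      · exact ⟨0, Or.inr (by simp)⟩
      · refine ⟨-1, Or.inr ?_⟩
        rw [zpow_neg_one, mul_inv_rev, ha', hb', mul_assoc, ha, mul_one]
    | one => exact ⟨0, Or.inl (by simp)⟩
    | mul x y _ _ hx hy =>
      obtain ⟨n, hn⟩ := hx
      obtain ⟨m, hm⟩ := hy
      rcases hn with rfl | rfl <;> rcases hm with rfl | rfl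
      · exact ⟨n + m, Or.inl (zpow_add _ _ _).symm⟩
      · exact ⟨n + m, Or.inr (by rw [zpow_add, mul_assoc])⟩
      · exact ⟨n - m, Or.inr (by rw [mul_assoc, hz, ← mul_assoc, ← zpow_add, sub_eq_add_neg])⟩
      · exact ⟨n - m, Or.inl (by
          rw [mul_assoc, ← mul_assoc a, hz, mul_assoc, ha, mul_one, ← zpow_add, sub_eq_add_neg])⟩
    | inv x _ hx =>
      obtain ⟨n, rfl | rfl⟩ := hx
      · exact ⟨-n, Or.inl (by rw [zpow_neg])⟩
      · exact ⟨n, Or.inr (by rw [mul_inv_rev, ha', ← zpow_neg, hz, neg_neg])⟩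
  rintro ⟨g, hg⟩
  obtain ⟨n, rfl | rfl⟩ := key g hg
  · refine ⟨k, Subtype.ext ?_⟩
    simp only [SubmonoidClass.mk_pow, OneMemClass.coe_one]
    rw [← zpow_natCast, ← zpow_mul, mul_comm, zpow_mul, zpow_natCast, hk, one_zpow]
  · refine ⟨1, Subtype.ext ?_⟩
    simp only [SubmonoidClass.mk_pow, OneMemClass.coe_one]
    rw [pow_one, pow_two, mul_assoc, ← mul_assoc a, hz, mul_assoc, ha, mul_one, ← zpow_add]
    simp

theorem exists_sylow_le_of_not_dvd_index [Finite G] {p : ℕ} [hp : Fact p.Prime] {H : Subgroup G}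
    (h : ¬ p ∣ H.index) : ∃ S : Sylow p G, (S : Subgroup G) ≤ H := by
  obtain ⟨P⟩ := (inferInstance : Nonempty (Sylow p H))
  have hP : IsPGroup p ((P : Subgroup H).map H.subtype) := P.2.map _
  have hi : ¬ p ∣ ((P : Subgroup H).map H.subtype).index := by
    rw [Subgroup.index_map_subtype]
    exact Nat.Prime.not_dvd_mul hp.out P.not_dvd_index h
  exact ⟨hP.toSylow hi, Subgroup.map_subtype_le _⟩

theorem exists_sylow_le_of_odd_index [Finite G] {H : Subgroup G} (h : Odd H.index) :
    ∃ S : Sylow 2 G, (S : Subgroup G) ≤ H := by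
  apply exists_sylow_le_of_not_dvd_index
  rwa [← even_iff_two_dvd, Nat.not_even_iff_odd]

theorem Sylow.odd_index [Finite G] (S : Sylow 2 G) : Odd (S : Subgroup G).index := by
  rw [← Nat.not_even_iff_odd, even_iff_two_dvd]
  exact S.not_dvd_index

theorem exists_mem_normalizing [Finite G] {P : Subgroup G} (hP : IsPGroup 2 P) {X : Set G}
    (hX : ∀ g, ∀ x ∈ X, g * x * g⁻¹ ∈ X) :
    ∀ n : ℕ, ∀ H : Subgroup G, H ≤ P → Nat.card H + n = Nat.card P → (∃ x ∈ X, x ∈ P ∧ x ∉ H) →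
    ∃ a ∈ X, a ∈ P ∧ a ∉ H ∧ ∀ d ∈ X, d ∈ H → a * d * a⁻¹ ∈ H := by
  intro n
  induction n using Nat.strong_induction_on with
  | _ n ih =>
  intro H hHP hn hx
  by_cases hc : ∃ a ∈ X, a ∈ P ∧ a ∉ H ∧ ∀ d ∈ H, a * d * a⁻¹ ∈ H
  · obtain ⟨a, h1, h2, h3, h4⟩ := hc
    exact ⟨a, h1, h2, h3, fun d _ hd => h4 d hd⟩
  push Not at hc
  have hne : H.subgroupOf P ≠ ⊤ := by
    intro h
    rw [Subgroup.subgroupOf_eq_top] at h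
    obtain ⟨x, -, h1, h2⟩ := hx
    exact h2 (h h1)
  have : Finite P := inferInstance
  have : Fact (Nat.Prime 2) := ⟨Nat.prime_two⟩
  have : Group.IsNilpotent P := hP.isNilpotent
  have hlt := Group.normalizerCondition_of_isNilpotent (G := P) (H.subgroupOf P) (lt_top_iff_ne_top.2 hne)
  set K := (Subgroup.normalizer (H.subgroupOf P : Set P)).map P.subtype with hK
  have hKP : K ≤ P := Subgroup.map_subtype_le _
  have hHK : H < K := by
    have : H = (H.subgroupOf P).map P.subtype := by
      rw [Subgroup.subgroupOf_map_subtype, inf_eq_left.2 hHP]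
    rw [this]
    exact (Subgroup.map_lt_map_iff_of_injective (Subgroup.subtype_injective P)).2 hlt
  have hKX : ∀ x ∈ X, x ∈ K → x ∈ H := by
    intro x hxX hxK
    by_contra hxH
    obtain ⟨d, hd, hd'⟩ := hc x hxX (hKP hxK) hxH
    obtain ⟨y, hy, rfl⟩ := hxK
    apply hd'
    have := (Subgroup.mem_normalizer_iff.1 hy ⟨d, hHP hd⟩).1 (by simpa [Subgroup.mem_subgroupOf] using hd)
    simpa [Subgroup.mem_subgroupOf] using this
  have hcard : Nat.card H < Nat.card K := by
    exact Set.ncard_lt_ncard (s := (H : Set G)) (t := (K : Set G)) hHK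
  have hcard2 : Nat.card K ≤ Nat.card P := Subgroup.card_le_of_le hKP
  obtain ⟨a, h1, h2, h3, h4⟩ := ih (Nat.card P - Nat.card K) (by omega) K hKP (by omega) (by
    obtain ⟨x, h1, h2, h3⟩ := hx
    exact ⟨x, h1, h2, fun h => h3 (hKX x h1 h)⟩)
  refine ⟨a, h1, h2, fun h => h3 (hHK.le h), fun d hd hdH => ?_⟩
  exact hKX _ (hX a d hd) (h4 d hd (hHK.le hdH))

theorem mem_sylow_of_forall_conj [Finite G] {t : G} (ht : t * t = 1)
    (h : ∀ g : G, ∃ k : ℕ, (t * (g * t * g⁻¹)) ^ 2 ^ k = 1) (S : Sylow 2 G) : t ∈ S := by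
  have : Fact (Nat.Prime 2) := ⟨Nat.prime_two⟩
  set X : Set G := {x | ∃ g, x = g * t * g⁻¹} with hXdef
  have hX : ∀ g, ∀ x ∈ X, g * x * g⁻¹ ∈ X := by
    rintro g _ ⟨c, rfl⟩
    exact ⟨g * c, by group⟩
  have hX2 : ∀ x ∈ X, x * x = 1 := by
    rintro _ ⟨c, rfl⟩
    have : c * t * c⁻¹ * (c * t * c⁻¹) = c * (t * t) * c⁻¹ := by group
    rw [this, ht]; group
  have hpair : ∀ a ∈ X, ∀ b ∈ X, IsPGroup 2 (Subgroup.closure {a, b}) := by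
    intro a ha b hb
    obtain ⟨c, hc⟩ := ha
    obtain ⟨d, hd⟩ := hb
    obtain ⟨k, hk⟩ := h (c⁻¹ * d)
    refine isPGroup_closure_pair (hX2 a ⟨c, hc⟩) (hX2 b ⟨d, hd⟩) (k := k) ?_
    have : a * b = c * (t * (c⁻¹ * d * t * (c⁻¹ * d)⁻¹)) * c⁻¹ := by rw [hc, hd]; group
    rw [this, conj_pow, hk]; group
  have hcard : ∀ S S' : Sylow 2 G, (X ∩ S).ncard = (X ∩ S').ncard := by
    intro S S'
    obtain ⟨g, rfl⟩ := MulAction.exists_smul_eq G S S'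
    rw [← Set.ncard_image_of_injective (X ∩ S) (MulAut.conj g).injective]
    congr 1
    ext x
    constructor
    · rintro ⟨y, ⟨h1, h2⟩, rfl⟩
      exact ⟨hX g y h1, by
        show MulAut.conj g y ∈ ((g • S : Sylow 2 G) : Subgroup G)
        rw [Sylow.coe_subgroup_smul]
        exact Subgroup.smul_mem_pointwise_smul _ (MulAut.conj g) _ h2⟩
    · rintro ⟨h1, h2⟩
      refine ⟨g⁻¹ * x * g, ⟨by simpa using hX g⁻¹ x h1, ?_⟩, by simp [mul_assoc]⟩
      change x ∈ ((g • S : Sylow 2 G) : Subgroup G) at h2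
      rw [Sylow.coe_subgroup_smul,
        Subgroup.mem_pointwise_smul_iff_inv_smul_mem] at h2
      have h3 : g⁻¹ * x * g ∈ (S : Subgroup G) := by simpa [MulAut.smul_def, ← map_inv] using h2
      exact h3
  have hnot : ∀ S S' : Sylow 2 G, X ∩ S ≠ X ∩ S' → ∃ x ∈ X, x ∈ S ∧ x ∉ S' := by
    intro S S' hne
    by_contra! hc
    apply hne
    refine Set.eq_of_subset_of_ncard_le ?_ (hcard S' S).le
    rintro x ⟨h1, h2⟩
    exact ⟨h1, hc x h1 h2⟩
  have main : ∀ n : ℕ, ∀ S S' : Sylow 2 G, X ∩ S ≠ X ∩ S' →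
      (X ∩ (S ∩ S') : Set G).ncard + n = Nat.card G → False := by
    intro n
    induction n using Nat.strong_induction_on with
    | _ n ih =>
    intro S S' hne hn
    set Δ : Set G := X ∩ (S ∩ S') with hΔ
    have hcl : Subgroup.closure Δ ≤ (S : Subgroup G) ⊓ S' := by
      rw [Subgroup.closure_le]
      exact fun x hx => hx.2
    have hΔmem : ∀ d ∈ X, d ∈ Subgroup.closure Δ ↔ d ∈ Δ :=
      fun d hd => ⟨fun h => ⟨hd, hcl h⟩, fun h => Subgroup.subset_closure h⟩
    have get : ∀ S₁ S₂ : Sylow 2 G, X ∩ (S₁ ∩ S₂) = Δ → X ∩ S₁ ≠ X ∩ S₂ →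
        ∃ a ∈ X, a ∈ S₁ ∧ a ∉ Δ ∧ ∀ d ∈ Δ, a * d * a⁻¹ ∈ Δ := by
      intro S₁ S₂ h12 hne
      have hle : Subgroup.closure Δ ≤ S₁ := by
        rw [← h12, Subgroup.closure_le]
        exact fun x hx => hx.2.1
      obtain ⟨x, h1, h2, h3⟩ := hnot S₁ S₂ hne
      obtain ⟨a, ha1, ha2, ha3, ha4⟩ := exists_mem_normalizing S₁.2 hX
        (Nat.card S₁ - Nat.card (Subgroup.closure Δ)) (Subgroup.closure Δ) hle (by
          have : Nat.card (Subgroup.closure Δ) ≤ Nat.card (S₁ : Subgroup G) :=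
            Subgroup.card_le_of_le hle
          exact Nat.add_sub_cancel' this) ⟨x, h1, h2, fun h => h3 (by
            rw [hΔmem x h1, ← h12] at h
            exact h.2.2)⟩
      refine ⟨a, ha1, ha2, fun h => ha3 (Subgroup.subset_closure h), fun d hd => ?_⟩
      have := ha4 d hd.1 (Subgroup.subset_closure hd)
      exact (hΔmem _ (hX a d hd.1)).1 this
    obtain ⟨a, ha1, ha2, ha3, ha4⟩ := get S S' rfl hne
    obtain ⟨b, hb1, hb2, hb3, hb4⟩ := get S' S (by rw [hΔ, Set.inter_comm (S : Set G)]) hne.symm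
    have hnorm : ∀ c : G, (∀ d ∈ Δ, c * d * c⁻¹ ∈ Δ) →
        c ∈ Subgroup.normalizer (Subgroup.closure Δ : Set G) := by
      intro c hc
      refine Subgroup.mem_normalizer_fintype ?_
      intro d hd
      have := Subgroup.mem_map_of_mem (MulAut.conj c).toMonoidHom hd
      rw [MonoidHom.map_closure] at this
      refine Subgroup.closure_mono ?_ this
      rintro _ ⟨e, he, rfl⟩
      exact hc e he
    have hP : IsPGroup 2 (Subgroup.closure {a, b} ⊔ Subgroup.closure Δ : Subgroup G) := by
      refine IsPGroup.to_sup_of_normal_right' (hpair a ha1 b hb1)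
        (S.2.to_le (hcl.trans inf_le_left)) ?_
      rw [Subgroup.closure_le]
      rintro x (rfl | rfl)
      · exact hnorm _ ha4
      · exact hnorm _ hb4
    obtain ⟨S'', hS''⟩ := hP.exists_le_sylow
    have haS : a ∈ S'' := hS'' (Subgroup.mem_sup_left (Subgroup.subset_closure (by simp)))
    have hbS : b ∈ S'' := hS'' (Subgroup.mem_sup_left (Subgroup.subset_closure (by simp)))
    have hΔS : ∀ d ∈ Δ, d ∈ S'' := fun d hd =>
      hS'' (Subgroup.mem_sup_right (Subgroup.subset_closure hd))
    have step : ∀ S₁ : Sylow 2 G, (∀ d ∈ Δ, d ∈ S₁) → ∀ c ∈ X, c ∈ S₁ → c ∈ S'' → c ∉ Δ →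
        X ∩ S₁ = X ∩ S'' := by
      intro S₁ h1 c hcX hc1 hc2 hc3
      by_contra hne
      have hlt : Δ.ncard < (X ∩ (S₁ ∩ S'') : Set G).ncard := by
        refine Set.ncard_lt_ncard ?_ (Set.toFinite _)
        refine Set.ssubset_iff_of_subset ?_ |>.2 ⟨c, ⟨hcX, hc1, hc2⟩, hc3⟩
        exact fun d hd => ⟨hd.1, h1 d hd, hΔS d hd⟩
      have hle : (X ∩ (S₁ ∩ S'') : Set G).ncard ≤ Nat.card G := Set.ncard_le_card _
      exact ih (Nat.card G - (X ∩ (S₁ ∩ S'') : Set G).ncard) (by omega) S₁ S'' hne (by omega)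
    apply hne
    rw [step S (fun d hd => hd.2.1) a ha1 ha2 haS ha3, step S' (fun d hd => hd.2.2) b hb1 hb2 hbS hb3]
  have hone : IsPGroup 2 (Subgroup.zpowers t) := by
    rintro ⟨g, n, rfl⟩
    refine ⟨1, Subtype.ext ?_⟩
    show (t ^ n) ^ 2 ^ 1 = 1
    rw [pow_one, pow_two, ← (Commute.refl t).mul_zpow, ht, one_zpow]
  obtain ⟨S₀, hS₀⟩ := hone.exists_le_sylow
  by_contra hS
  refine main (Nat.card G - (X ∩ (S ∩ S₀) : Set G).ncard) S S₀ ?_ ?_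
  · intro heq
    have htX : t ∈ X ∩ S₀ := ⟨⟨1, by simp⟩, hS₀ (Subgroup.mem_zpowers t)⟩
    rw [← heq] at htX
    exact hS htX.2
  · have := Set.ncard_le_card (X ∩ (S ∩ S₀) : Set G)
    exact Nat.add_sub_cancel' this

theorem conj_involution_mul {t b : G} (ht : t * t = 1) (hb : b * b = 1) :
    t * (t * b) * t⁻¹ = (t * b)⁻¹ := by
  rw [mul_inv_rev, inv_eq_of_mul_eq_one_left ht, inv_eq_of_mul_eq_one_left hb, ← mul_assoc, ht,
    one_mul]

theorem conj_conj_self {t g : G} (ht : t * t = 1) : g * t * g⁻¹ * (g * t * g⁻¹) = 1 := by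
  have : g * t * g⁻¹ * (g * t * g⁻¹) = g * (t * t) * g⁻¹ := by group
  rw [this, ht]; group

theorem exists_odd_inverted [Finite G] {t : G} (ht : t * t = 1) {H : Subgroup G} (hH : Odd H.index)
    (htH : t ∉ H) : ∃ (g : G) (j : ℕ), (t * (g * t * g⁻¹)) ^ j ≠ 1 ∧
      Odd (orderOf ((t * (g * t * g⁻¹)) ^ j)) ∧
      t * (t * (g * t * g⁻¹)) ^ j * t⁻¹ = ((t * (g * t * g⁻¹)) ^ j)⁻¹ := by
  obtain ⟨S, hS⟩ := exists_sylow_le_of_odd_index hH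
  by_contra! hc
  refine htH (hS (mem_sylow_of_forall_conj ht (fun g => ?_) S))
  by_contra! hg
  obtain ⟨k, hk⟩ := exists_pow_two_pow_odd_orderOf (t * (g * t * g⁻¹))
  refine hc g (2 ^ k) (hg k) hk ?_
  rw [← conj_pow, conj_involution_mul ht (conj_conj_self ht), inv_pow]

end Tools

theorem Commute.exists_eq_zpow_mul_zpow_of_mem_closure {G : Type*} [Group G] {x w : G}
    (h : Commute x w) {a : G} (ha : a ∈ Subgroup.closure {x, w}) : ∃ i j : ℤ, a = x ^ i * w ^ j := by
  induction ha using Subgroup.closure_induction with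
  | mem y hy =>
    rcases hy with rfl | rfl
    · exact ⟨1, 0, by simp⟩
    · exact ⟨0, 1, by simp⟩
  | one => exact ⟨0, 0, by simp⟩
  | mul y z _ _ hy hz =>
    obtain ⟨i, j, rfl⟩ := hy
    obtain ⟨k, l, rfl⟩ := hz
    refine ⟨i + k, j + l, ?_⟩
    rw [zpow_add, zpow_add, mul_assoc, ← mul_assoc (w ^ j), (h.symm.zpow_zpow j k).eq]
    simp only [mul_assoc]
  | inv y _ hy =>
    obtain ⟨i, j, rfl⟩ := hy
    refine ⟨-i, -j, ?_⟩
    rw [mul_inv_rev, zpow_neg, zpow_neg, ← zpow_neg, ← zpow_neg, (h.symm.zpow_zpow _ _).eq]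

theorem isCyclic_of_fixedPointFree {A M : Type*} [CommGroup A] [Finite A] [AddCommGroup M]
    [Finite M] [Nontrivial M] (ρ : A →* AddMonoid.End M)
    (h : ∀ a : A, a ≠ 1 → ∀ m : M, ρ a m = m → m = 0) : IsCyclic A := by
  let φ : MonoidAlgebra ℤ A →ₐ[ℤ] AddMonoid.End M := MonoidAlgebra.lift ℤ (AddMonoid.End M) A ρ
  let : Module (MonoidAlgebra ℤ A) M := Module.compHom M φ.toRingHom
  have hsmul : ∀ (a : A) (m : M), MonoidAlgebra.of ℤ A a • m = ρ a m := by
    intro a m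
    have h1 : MonoidAlgebra.of ℤ A a • m = φ (MonoidAlgebra.of ℤ A a) m := rfl
    rw [h1]
    simp [φ]
  have : Finite (Submodule (MonoidAlgebra ℤ A) M) :=
    Finite.of_injective (fun S => (S : Set M)) SetLike.coe_injective
  obtain ⟨S, hS, -⟩ := (eq_bot_or_exists_atom_le (⊤ : Submodule (MonoidAlgebra ℤ A) M)).resolve_left
    (by exact top_ne_bot)
  have : IsSimpleModule (MonoidAlgebra ℤ A) S := isSimpleModule_iff_isAtom.2 hS
  obtain ⟨I, hI, ⟨e⟩⟩ := isSimpleModule_iff_quot_maximal.1 this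
  have hD : IsDomain (MonoidAlgebra ℤ A ⧸ I) := Ideal.Quotient.isDomain I
  refine isCyclic_of_injective_ringHom
    ((Ideal.Quotient.mk I).toMonoidHom.comp (MonoidAlgebra.of ℤ A)) ?_
  rw [injective_iff_map_eq_one]
  intro a ha
  by_contra hne
  let s : S := e.symm 1
  have hs : s ≠ 0 := by
    intro h0
    have : e s = 0 := by rw [h0, map_zero]
    simp [s] at this
  have hfix : MonoidAlgebra.of ℤ A a • s = s := by
    apply e.injective
    rw [map_smul]
    simp only [s, LinearEquiv.apply_symm_apply]
    have h2 : MonoidAlgebra.of ℤ A a • (1 : MonoidAlgebra ℤ A ⧸ I) =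
      Ideal.Quotient.mk I (MonoidAlgebra.of ℤ A a) := by
      change Ideal.Quotient.mk I (MonoidAlgebra.of ℤ A a * 1) = _
      rw [mul_one]
    rw [h2]
    exact ha
  apply hs
  apply Subtype.ext
  apply h a hne
  rw [← hsmul]
  exact congrArg Subtype.val hfix

theorem exists_zpow_generator {L N : Type*} [Group L] [Finite L] [Group N] [Finite N] [Nontrivial N]
    [MulDistribMulAction L N] (hN : ∀ n : N, n * n = 1) {x w : L} (hxw : Commute x w)
    (h : ∀ i j : ℤ, x ^ i * w ^ j ≠ 1 → ∀ n : N, (x ^ i * w ^ j) • n = n → n = 1) :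
    ∃ i j : ℤ, x ∈ Subgroup.zpowers (x ^ i * w ^ j) ∧ w ∈ Subgroup.zpowers (x ^ i * w ^ j) := by
  let : CommGroup N := { ‹Group N› with
    mul_comm := fun a b => by
      have h1 := hN (a * b)
      have ha : a⁻¹ = a := inv_eq_of_mul_eq_one_left (hN a)
      have hb : b⁻¹ = b := inv_eq_of_mul_eq_one_left (hN b)
      have h3 := eq_inv_of_mul_eq_one_left h1
      rw [mul_inv_rev, ha, hb] at h3
      exact h3 }
  have hcl : IsMulCommutative (Subgroup.closure {x, w}) := Subgroup.isMulCommutative_closure (by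
    rintro a (rfl | rfl) b (rfl | rfl)
    · rfl
    · exact hxw
    · exact hxw.symm
    · rfl)
  let : CommGroup (Subgroup.closure {x, w}) :=
    { (Subgroup.closure {x, w}).toGroup with mul_comm := fun a b => hcl.is_comm.comm a b }
  let ρ : Subgroup.closure {x, w} →* AddMonoid.End (Additive N) :=
    { toFun := fun a =>
        { toFun := fun m => Additive.ofMul ((a : L) • m.toMul)
          map_zero' := by simp
          map_add' := fun m n => by simp }
      map_one' := by ext m; exact congrArg Additive.ofMul (one_smul L m.toMul)
      map_mul' := fun a b => by
        ext m
        change Additive.ofMul (((a : L) * b) • m.toMul) = Additive.ofMul ((a : L) • (b : L) • m.toMul)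
        rw [mul_smul] }
  have hc : IsCyclic (Subgroup.closure {x, w}) := by
    refine isCyclic_of_fixedPointFree ρ ?_
    rintro ⟨a, ha⟩ hne m hm
    obtain ⟨i, j, rfl⟩ := hxw.exists_eq_zpow_mul_zpow_of_mem_closure ha
    exact h i j (fun h0 => hne (Subtype.ext h0)) m.toMul hm
  obtain ⟨⟨g, hg⟩, hgen⟩ := hc.exists_generator
  obtain ⟨i, j, rfl⟩ := hxw.exists_eq_zpow_mul_zpow_of_mem_closure hg
  refine ⟨i, j, ?_, ?_⟩
  · obtain ⟨k, hk⟩ := hgen ⟨x, Subgroup.subset_closure (by simp)⟩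
    exact ⟨k, congrArg Subtype.val hk⟩
  · obtain ⟨k, hk⟩ := hgen ⟨w, Subgroup.subset_closure (by simp)⟩
    exact ⟨k, congrArg Subtype.val hk⟩

/-- `y` is a nontrivial element of odd order inverted by `t`. -/
structure OddInverted {L : Type*} [Group L] (t y : L) : Prop where
  ne_one : y ≠ 1
  odd : Odd (orderOf y)
  conj : t * y * t⁻¹ = y⁻¹

/-- A faithful action by automorphisms on a group of exponent two, such that all orbits have odd
length, and odd order elements conjugate to their inverse by some element act without fixed
points and have centralizers transitive on each orbit. -/
structure RealSemiregular (L N : Type*) [Group L] [Group N] [MulDistribMulAction L N] : Prop where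
  two : ∀ n : N, n * n = 1
  faithful : ∀ a : L, (∀ n : N, a • n = n) → a = 1
  stab : ∀ n : N, Odd (MulAction.stabilizer L n).index
  free : ∀ t y : L, OddInverted t y → ∀ n : N, y • n = n → n = 1
  trans : ∀ t y : L, OddInverted t y → ∀ (n : N) (g : L), ∃ d : L, Commute d y ∧ d • n = g • n

theorem mul_comm_of_mul_self {N : Type*} [Group N] (hN : ∀ n : N, n * n = 1) (a b : N) :
    a * b = b * a := by
  have ha : a⁻¹ = a := inv_eq_of_mul_eq_one_left (hN a)
  have hb : b⁻¹ = b := inv_eq_of_mul_eq_one_left (hN b)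
  have h3 := eq_inv_of_mul_eq_one_left (hN (a * b))
  rw [mul_inv_rev, ha, hb] at h3
  exact h3

theorem odd_order_of_mul_self {L : Type*} [Group L] {a : L} (ha : a * a = 1)
    (ho : Odd (orderOf a)) : a = 1 :=
  odd_pow_two_pow_eq_one ho (k := 1) (by rw [pow_one, pow_two, ha])

section Inverted

variable {L : Type*} [Group L]

theorem conj_eq_inv_of_mem_zpowers {t x a : L} (h : t * x * t⁻¹ = x⁻¹)
    (ha : a ∈ Subgroup.zpowers x) : t * a * t⁻¹ = a⁻¹ := by
  obtain ⟨n, rfl⟩ := ha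
  change t * x ^ n * t⁻¹ = (x ^ n)⁻¹
  rw [← conj_zpow, h, inv_zpow]

theorem odd_orderOf_of_mem_zpowers {x a : L} (h : Odd (orderOf x))
    (ha : a ∈ Subgroup.zpowers x) : Odd (orderOf a) :=
  Odd.of_dvd_nat h (orderOf_dvd_of_mem_zpowers ha)

theorem OddInverted.of_mem_zpowers {t x a : L} (h : OddInverted t x)
    (ha : a ∈ Subgroup.zpowers x) (hne : a ≠ 1) : OddInverted t a :=
  ⟨hne, odd_orderOf_of_mem_zpowers h.odd ha, conj_eq_inv_of_mem_zpowers h.conj ha⟩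

theorem mul_inverted_mul_self {t a : L} (ht : t * t = 1) (h : t * a * t⁻¹ = a⁻¹) :
    t * a * (t * a) = 1 := by
  rw [inv_eq_of_mul_eq_one_left ht] at h
  rw [← mul_assoc, h, inv_mul_cancel]

theorem mul_inverted_ne_one {t a : L} (ht : t * t = 1) (ht1 : t ≠ 1) (ho : Odd (orderOf a)) :
    t * a ≠ 1 := by
  intro h
  have h1 : t = a⁻¹ := eq_inv_of_mul_eq_one_left h
  apply ht1
  apply odd_order_of_mul_self ht
  rw [h1, orderOf_inv]
  exact ho

theorem exists_mul_self_eq_of_odd {x : L} (h : Odd (orderOf x)) :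
    ∃ z ∈ Subgroup.zpowers x, z * z = x := by
  obtain ⟨m, hm⟩ := h
  refine ⟨x ^ (m + 1), Subgroup.npow_mem_zpowers x _, ?_⟩
  rw [← pow_add]
  have : m + 1 + (m + 1) = orderOf x + 1 := by omega
  rw [this, pow_succ, pow_orderOf_eq_one, one_mul]

theorem mul_inverted_eq_conj {t z : L} (h : t * z * t⁻¹ = z⁻¹) :
    t * (z * z) = z⁻¹ * t * z⁻¹⁻¹ := by
  have h1 : t * z = z⁻¹ * t := by rw [← h, inv_mul_cancel_right]
  rw [← mul_assoc, h1, inv_inv]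

end Inverted

section Fixed

variable {L N : Type*} [Group L] [Group N] [MulDistribMulAction L N]

/-- The subgroup of fixed points of one operator. -/
def fixedSubgroup (N : Type*) [Group N] [MulDistribMulAction L N] (a : L) : Subgroup N where
  carrier := {n | a • n = n}
  one_mem' := smul_one a
  mul_mem' := by
    intro m n hm hn
    change a • (m * n) = m * n
    rw [smul_mul', hm, hn]
  inv_mem' := by
    intro m hm
    change a • m⁻¹ = m⁻¹
    rw [smul_inv', hm]

theorem card_fixedSubgroup_conj [Finite N] (g a : L) :
    Nat.card (fixedSubgroup N (g * a * g⁻¹)) = Nat.card (fixedSubgroup N a) := by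
  symm
  refine Nat.card_congr ((MulAction.toPerm g : Equiv.Perm N).subtypeEquiv fun n => ?_)
  change a • n = n ↔ (g * a * g⁻¹) • g • n = g • n
  rw [mul_smul, mul_smul, inv_smul_smul, smul_left_cancel_iff]

theorem card_mul_add_one_le [Finite N] {ι : Type*} [Finite ι] (s : ι → Subgroup N) {h : ℕ}
    (hs : ∀ i, Nat.card (s i) = h) (hd : ∀ i j, i ≠ j → ∀ n, n ∈ s i → n ∈ s j → n = 1) :
    Nat.card ι * (h - 1) + 1 ≤ Nat.card N ∧
      ((∀ n, ∃ i, n ∈ s i) → Nat.card ι * (h - 1) + 1 = Nat.card N) := by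
  classical
  have := Fintype.ofFinite ι
  have hcompl : ∀ K : Subgroup N, Nat.card {n : N // n ∈ K ∧ n ≠ 1} + 1 = Nat.card K := by
    intro K
    have h1 := Set.ncard_sdiff_singleton_add_one (s := (K : Set N)) (a := 1) K.one_mem
    exact h1
  have hN : Nat.card {n : N // n ∈ (⊤ : Subgroup N) ∧ n ≠ 1} + 1 = Nat.card N := by
    rw [hcompl, Subgroup.card_top]
  have hsig : Nat.card (Σ i, {n : N // n ∈ s i ∧ n ≠ 1}) = Nat.card ι * (h - 1) := by
    rw [Nat.card_sigma, Finset.sum_congr rfl (g := fun _ => h - 1), Finset.sum_const,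
      Finset.card_univ, Nat.card_eq_fintype_card, smul_eq_mul]
    intro i _
    have := hcompl (s i)
    rw [hs i] at this
    omega
  let f : (Σ i, {n : N // n ∈ s i ∧ n ≠ 1}) → {n : N // n ∈ (⊤ : Subgroup N) ∧ n ≠ 1} :=
    fun p => ⟨p.2.1, Subgroup.mem_top _, p.2.2.2⟩
  have hf : Function.Injective f := by
    rintro ⟨i, n, hn⟩ ⟨j, m, hm⟩ he
    have hnm : n = m := congrArg Subtype.val he
    subst hnm
    by_cases hij : i = j
    · subst hij; rfl
    · exact absurd (hd i j hij n hn.1 hm.1) hn.2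
  constructor
  · rw [← hsig, ← hN]
    exact Nat.add_le_add_right (Nat.card_le_card_of_injective f hf) 1
  · intro hc
    rw [← hsig, ← hN]
    congr 1
    refine Nat.card_congr (Equiv.ofBijective f ⟨hf, ?_⟩)
    rintro ⟨n, -, hn⟩
    obtain ⟨i, hi⟩ := hc n
    exact ⟨⟨i, n, hi, hn⟩, rfl⟩

end Fixed

theorem orderOf_dvd_card_sub_one {L N : Type*} [Group L] [Finite L] [Group N] [Finite N]
    [MulDistribMulAction L N] {x : L} {F : Subgroup N} (hF : ∀ n ∈ F, x • n ∈ F)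
    (hfree : ∀ a ∈ Subgroup.zpowers x, a ≠ 1 → ∀ n : N, a • n = n → n = 1) :
    orderOf x ∣ Nat.card F - 1 := by
  have hz : ∀ a ∈ Subgroup.zpowers x, ∀ n ∈ F, a • n ∈ F := by
    intro a ha n hn
    rw [← mem_powers_iff_mem_zpowers] at ha
    obtain ⟨k, rfl⟩ := ha
    change x ^ k • n ∈ F
    induction k with
    | zero => simpa using hn
    | succ k ih => rw [pow_succ', mul_smul]; exact hF _ ih
  let act : MulAction (Subgroup.zpowers x) {n : N // n ∈ F ∧ n ≠ 1} :=
    { smul := fun a n => ⟨(a : L) • n.1, hz a a.2 _ n.2.1, fun h => n.2.2 (by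
        rwa [smul_eq_iff_eq_inv_smul, smul_one] at h)⟩
      one_smul := fun n => Subtype.ext (one_smul L n.1)
      mul_smul := fun a b n => Subtype.ext (mul_smul (a : L) (b : L) n.1) }
  have hst : ∀ n : {n : N // n ∈ F ∧ n ≠ 1},
      MulAction.stabilizer (Subgroup.zpowers x) n = ⊥ := by
    intro n
    rw [Subgroup.eq_bot_iff_forall]
    intro a ha
    by_contra hne
    exact n.2.2 (hfree a a.2 (fun h => hne (Subtype.ext h)) n.1 (congrArg Subtype.val ha))
  have hc := Nat.card_congr (MulAction.selfEquivOrbitsQuotientProd hst)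
  rw [Nat.card_prod, Nat.card_zpowers] at hc
  have h1 : Nat.card {n : N // n ∈ F ∧ n ≠ 1} + 1 = Nat.card F :=
    Set.ncard_sdiff_singleton_add_one (s := (F : Set N)) (a := 1) F.one_mem
  have h2 : Nat.card F - 1 = Nat.card {n : N // n ∈ F ∧ n ≠ 1} := by omega
  rw [h2, hc]
  exact Dvd.intro_left _ rfl

theorem card_fixedSubgroup_mul {L N : Type*} [Group L] [Group N] [Finite N]
    [MulDistribMulAction L N] {t x a : L} (h : OddInverted t x)
    (ha : a ∈ Subgroup.zpowers x) :
    Nat.card (fixedSubgroup N (t * a)) = Nat.card (fixedSubgroup N t) := by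
  obtain ⟨z, hz, rfl⟩ := exists_mul_self_eq_of_odd (odd_orderOf_of_mem_zpowers h.odd ha)
  rw [mul_inverted_eq_conj (conj_eq_inv_of_mem_zpowers h.conj
    ((Subgroup.zpowers_le.2 ha) hz)), card_fixedSubgroup_conj]

namespace RealSemiregular

variable {L N : Type*} [Group L] [Finite L] [Group N] [Finite N] [MulDistribMulAction L N]

theorem exists_oddInverted (H : RealSemiregular L N) {t : L} (ht : t * t = 1) (ht1 : t ≠ 1) :
    ∃ y : L, OddInverted t y := by
  have : ∃ n : N, t • n ≠ n := by
    by_contra! hc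
    exact ht1 (H.faithful t hc)
  obtain ⟨n, hn⟩ := this
  obtain ⟨g, j, h1, h2, h3⟩ := exists_odd_inverted ht (H.stab n) (fun h => hn h)
  exact ⟨_, h1, h2, h3⟩

theorem eq_one_of_smul_eq (H : RealSemiregular L N) {t x : L} (h : OddInverted t x) {a b : L}
    (ha : a ∈ Subgroup.zpowers x) (hb : b ∈ Subgroup.zpowers x) (hab : a ≠ b) {n : N}
    (h1 : (t * a) • n = n) (h2 : (t * b) • n = n) : n = 1 := by
  refine H.free t (a⁻¹ * b) (h.of_mem_zpowers (mul_mem (inv_mem ha) hb) ?_) n ?_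
  · rwa [ne_eq, inv_mul_eq_one]
  · rw [mul_smul] at h1 h2
    rw [mul_smul, inv_smul_eq_iff]
    exact smul_left_cancel t (h2.trans h1.symm)

theorem card_fixedSubgroup_mul_self (H : RealSemiregular L N) {t : L} (ht : t * t = 1)
    (ht1 : t ≠ 1) :
    Nat.card (fixedSubgroup N t) * Nat.card (fixedSubgroup N t) = Nat.card N := by
  apply le_antisymm
  · obtain ⟨y, hy⟩ := H.exists_oddInverted ht ht1
    have h1 := card_fixedSubgroup_mul (N := N) hy (Subgroup.mem_zpowers y)
    have hd : Disjoint (fixedSubgroup N t) (fixedSubgroup N (t * y)) := by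
      rw [Subgroup.disjoint_def]
      intro n hn hn'
      refine H.eq_one_of_smul_eq hy (one_mem _) (Subgroup.mem_zpowers y) hy.ne_one.symm ?_ hn'
      rw [mul_one]; exact hn
    have h2 := Nat.card_le_card_of_injective _ (Subgroup.mul_injective_of_disjoint hd)
    rw [Nat.card_prod, h1] at h2
    exact h2
  · have hc := mul_comm_of_mul_self H.two
    let φ : N →* N :=
      { toFun := fun n => n * t • n
        map_one' := by simp
        map_mul' := fun a b => by
          rw [smul_mul', mul_assoc, mul_assoc, ← mul_assoc b, ← mul_assoc (t • a), hc b] }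
    have h1 : φ.range ≤ fixedSubgroup N t := by
      rintro _ ⟨n, rfl⟩
      change t • (n * t • n) = n * t • n
      rw [smul_mul', ← mul_smul, ht, one_smul, hc]
    have h2 : φ.ker ≤ fixedSubgroup N t := by
      intro n hn
      change n * t • n = 1 at hn
      change t • n = n
      rw [eq_inv_of_mul_eq_one_right hn, inv_eq_of_mul_eq_one_left (H.two n)]
    rw [← Subgroup.card_mul_index φ.ker, Subgroup.index_ker]
    exact Nat.mul_le_mul (Subgroup.card_le_of_le h2) (Subgroup.card_le_of_le h1)

theorem card_fixedSubgroup_eq (H : RealSemiregular L N) {t s : L} (ht : t * t = 1) (ht1 : t ≠ 1)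
    (hs : s * s = 1) (hs1 : s ≠ 1) :
    Nat.card (fixedSubgroup N t) = Nat.card (fixedSubgroup N s) :=
  Nat.mul_self_inj.1 ((H.card_fixedSubgroup_mul_self ht ht1).trans
    (H.card_fixedSubgroup_mul_self hs hs1).symm)

theorem one_lt_card_fixedSubgroup (H : RealSemiregular L N) {t : L} (ht : t * t = 1) (ht1 : t ≠ 1) :
    1 < Nat.card (fixedSubgroup N t) := by
  have h1 := H.card_fixedSubgroup_mul_self ht ht1
  have : Nontrivial N := by
    rw [← not_subsingleton_iff_nontrivial]
    intro h
    exact ht1 (H.faithful t fun n => Subsingleton.elim _ _)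
  have h2 := Finite.one_lt_card (α := N)
  by_contra hc
  have h3 : Nat.card (fixedSubgroup N t) ≤ 1 := by omega
  have := Nat.mul_le_mul h3 h3
  omega

theorem exists_maximal (H : RealSemiregular L N) {t y : L} (ht1 : t ≠ 1)
    (hy : OddInverted t y) : ∃ x, OddInverted t x ∧ y ∈ Subgroup.zpowers x ∧
      ∀ w, OddInverted t w → Commute x w → w ∈ Subgroup.zpowers x := by
  have : Nontrivial N := by
    rw [← not_subsingleton_iff_nontrivial]
    intro h
    exact ht1 (H.faithful t fun n => Subsingleton.elim _ _)
  obtain ⟨x, ⟨hx, hxy⟩, hmax⟩ := Set.exists_max_image {x | OddInverted t x ∧ Commute x y} orderOf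
    (Set.toFinite _) ⟨y, hy, Commute.refl y⟩
  have key : ∀ w, OddInverted t w → Commute w y → Commute x w → w ∈ Subgroup.zpowers x := by
    intro w hw hwy hxw
    have hinv : ∀ i j : ℤ, x ^ i * w ^ j ≠ 1 → OddInverted t (x ^ i * w ^ j) := by
      intro i j hne
      refine ⟨hne, ?_, ?_⟩
      · have hc : Commute (x ^ i) (w ^ j) := hxw.zpow_zpow i j
        exact Odd.of_dvd_nat ((odd_orderOf_of_mem_zpowers hx.odd (Subgroup.zpow_mem_zpowers x i)).mul
          (odd_orderOf_of_mem_zpowers hw.odd (Subgroup.zpow_mem_zpowers w j)))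
          hc.orderOf_mul_dvd_mul_orderOf
      · have h1 := conj_eq_inv_of_mem_zpowers hx.conj (Subgroup.zpow_mem_zpowers x i)
        have h2 := conj_eq_inv_of_mem_zpowers hw.conj (Subgroup.zpow_mem_zpowers w j)
        have : t * (x ^ i * w ^ j) * t⁻¹ = (t * x ^ i * t⁻¹) * (t * w ^ j * t⁻¹) := by group
        rw [this, h1, h2, ← mul_inv_rev, (hxw.zpow_zpow i j).eq]
    obtain ⟨i, j, h1, h2⟩ := exists_zpow_generator H.two hxw
      (fun i j hne n hn => H.free t _ (hinv i j hne) n hn)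
    have hg1 : x ^ i * w ^ j ≠ 1 := by
      intro h
      rw [h] at h1
      simp at h1
      exact hx.ne_one h1
    have hg2 : Commute (x ^ i * w ^ j) y := (hxy.zpow_left i).mul_left (hwy.zpow_left j)
    have hle := hmax _ ⟨hinv i j hg1, hg2⟩
    have heq : Subgroup.zpowers x = Subgroup.zpowers (x ^ i * w ^ j) := by
      apply Subgroup.eq_of_le_of_card_ge (Subgroup.zpowers_le.2 h1)
      rw [Nat.card_zpowers, Nat.card_zpowers]
      exact hle
    rw [heq]; exact h2
  have hyx := key y hy (Commute.refl y) hxy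
  refine ⟨x, hx, hyx, fun w hw hxw => key w hw ?_ hxw⟩
  obtain ⟨k, rfl⟩ := hyx
  exact (hxw.zpow_left k).symm

end RealSemiregular

namespace RealSemiregular

variable {L N : Type*} [Group L] [Finite L] [Group N] [Finite N] [MulDistribMulAction L N]

theorem exists_mul_smul_eq (H : RealSemiregular L N) {t x : L} (ht : t * t = 1)
    (hx : OddInverted t x) (hmax : ∀ w, OddInverted t w → Commute x w → w ∈ Subgroup.zpowers x)
    (n : N) : ∃ a ∈ Subgroup.zpowers x, (t * a) • n = n := by
  set E : Subgroup L := Subgroup.normalizer (Subgroup.zpowers x : Set L) with hE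
  have htE : t ∈ E := by
    apply Subgroup.mem_normalizer_fintype
    intro a ha
    change t * a * t⁻¹ ∈ Subgroup.zpowers x
    rw [conj_eq_inv_of_mem_zpowers hx.conj ha]
    exact inv_mem ha
  have hdE : ∀ d : L, Commute d x → d ∈ E := by
    intro d hd
    apply Subgroup.mem_normalizer_fintype
    rintro _ ⟨k, rfl⟩
    change d * x ^ k * d⁻¹ ∈ Subgroup.zpowers x
    rw [(hd.zpow_right k).eq, mul_inv_cancel_right]
    exact Subgroup.zpow_mem_zpowers x k
  have : ((Subgroup.zpowers x).subgroupOf E).Normal := Subgroup.normal_in_normalizer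
  set Z := (Subgroup.zpowers x).subgroupOf E with hZ
  have hst : Odd (MulAction.stabilizer E n).index := by
    rw [MulAction.index_stabilizer]
    have : MulAction.orbit E n = MulAction.orbit L n := by
      ext m
      constructor
      · rintro ⟨g, rfl⟩
        exact ⟨g, rfl⟩
      · rintro ⟨g, rfl⟩
        obtain ⟨d, hd, hd'⟩ := H.trans t x hx n g
        exact ⟨⟨d, hdE d hd⟩, hd'⟩
    rw [this, ← MulAction.index_stabilizer]
    exact H.stab n
  have hmk := QuotientGroup.mk'_surjective Z
  have hodd : Odd ((MulAction.stabilizer E n).map (QuotientGroup.mk' Z)).index :=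
    Odd.of_dvd_nat hst (Subgroup.index_map_dvd _ hmk)
  set te : E := ⟨t, htE⟩ with hte
  by_cases hmem : QuotientGroup.mk' Z te ∈ (MulAction.stabilizer E n).map (QuotientGroup.mk' Z)
  · obtain ⟨s, hs, hst⟩ := hmem
    have h1 : te⁻¹ * s ∈ Z := QuotientGroup.eq.1 hst.symm
    refine ⟨t⁻¹ * s, h1, ?_⟩
    rw [mul_inv_cancel_left]
    exact hs
  · exfalso
    have hte2 : te * te = 1 := Subtype.ext ht
    obtain ⟨g, j, h1, h2, h3⟩ := exists_odd_inverted (by rw [← map_mul, hte2, map_one]) hodd hmem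
    obtain ⟨e, rfl⟩ := hmk g
    rw [← map_inv, ← map_mul, ← map_mul, ← map_mul, ← map_pow] at h1 h2
    set v : E := (te * (e * te * e⁻¹)) ^ j with hv
    have hvZ : v ∉ Z := fun h => h1 ((QuotientGroup.eq_one_iff v).2 h)
    have hee : (e * te * e⁻¹ : E) * (e * te * e⁻¹) = 1 := conj_conj_self hte2
    have hinv : t * v * t⁻¹ = (v : L)⁻¹ := by
      have : te * v * te⁻¹ = v⁻¹ := by
        rw [hv, ← conj_pow, conj_involution_mul hte2 hee, inv_pow]
      exact congrArg Subtype.val this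
    have hvo : Odd (orderOf (v : L)) := by
      have hm : v ^ orderOf (QuotientGroup.mk' Z v) ∈ Z := by
        rw [← QuotientGroup.eq_one_iff]
        exact pow_orderOf_eq_one (QuotientGroup.mk' Z v)
      have hm2 : (v : L) ^ orderOf (QuotientGroup.mk' Z v) ∈ Subgroup.zpowers x := hm
      have h4 : (v : L) ^ (orderOf (QuotientGroup.mk' Z v) * orderOf x) = 1 := by
        rw [pow_mul, ← orderOf_dvd_iff_pow_eq_one]
        exact orderOf_dvd_of_mem_zpowers hm2
      exact Odd.of_dvd_nat (h2.mul hx.odd) (orderOf_dvd_of_pow_eq_one h4)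
    have hcomm : Commute x v := by
      have hex : (e : L)⁻¹ * x * e ∈ Subgroup.zpowers x := by
        have := (Subgroup.mem_normalizer_iff.1 (inv_mem e.2) x).1 (Subgroup.mem_zpowers x)
        rwa [inv_inv] at this
      have h5 := conj_eq_inv_of_mem_zpowers hx.conj hex
      have h6 : ((e : L) * t * (e : L)⁻¹) * x * ((e : L) * t * (e : L)⁻¹)⁻¹ = x⁻¹ := by
        have : ((e : L) * t * (e : L)⁻¹) * x * ((e : L) * t * (e : L)⁻¹)⁻¹ =
          e * (t * ((e : L)⁻¹ * x * e) * t⁻¹) * (e : L)⁻¹ := by group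
        rw [this, h5]; group
      have h7 : (t * ((e : L) * t * (e : L)⁻¹)) * x * (t * ((e : L) * t * (e : L)⁻¹))⁻¹ = x := by
        have : (t * ((e : L) * t * (e : L)⁻¹)) * x * (t * ((e : L) * t * (e : L)⁻¹))⁻¹ =
          t * (((e : L) * t * (e : L)⁻¹) * x * ((e : L) * t * (e : L)⁻¹)⁻¹) * t⁻¹ := by group
        rw [this, h6, conj_eq_inv_of_mem_zpowers hx.conj (inv_mem (Subgroup.mem_zpowers x)), inv_inv]
      have h8 : Commute x (t * ((e : L) * t * (e : L)⁻¹)) := (mul_inv_eq_iff_eq_mul.1 h7).symm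
      have h9 : (v : L) = (t * ((e : L) * t * (e : L)⁻¹)) ^ j := rfl
      rw [h9]
      exact h8.pow_right j
    refine hvZ (hmax v ⟨fun h => hvZ ?_, hvo, hinv⟩ hcomm)
    have : v = 1 := Subtype.ext h
    rw [this]; exact one_mem _

theorem orderOf_eq (H : RealSemiregular L N) {t x : L} (ht : t * t = 1) (ht1 : t ≠ 1)
    (hx : OddInverted t x) (hmax : ∀ w, OddInverted t w → Commute x w → w ∈ Subgroup.zpowers x) :
    orderOf x = Nat.card (fixedSubgroup N t) + 1 := by
  have h1 := (card_mul_add_one_le (fun a : Subgroup.zpowers x => fixedSubgroup N (t * (a : L)))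
    (fun a => card_fixedSubgroup_mul (N := N) hx a.2)
    (fun a b hab n ha hb => H.eq_one_of_smul_eq hx a.2 b.2 (fun h => hab (Subtype.ext h)) ha hb)).2
    (fun n => by
      obtain ⟨a, ha, han⟩ := H.exists_mul_smul_eq ht hx hmax n
      exact ⟨⟨a, ha⟩, han⟩)
  rw [Nat.card_zpowers, ← H.card_fixedSubgroup_mul_self ht ht1] at h1
  have h2 := H.one_lt_card_fixedSubgroup ht ht1
  obtain ⟨m, hm⟩ : ∃ m, Nat.card (fixedSubgroup N t) = m + 2 := ⟨_, (Nat.sub_add_cancel h2).symm⟩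
  rw [hm] at h1 ⊢
  have h3 : (m + 1) * orderOf x = (m + 1) * (m + 2 + 1) := by
    have : m + 2 - 1 = m + 1 := rfl
    rw [this] at h1
    linarith
  exact Nat.eq_of_mul_eq_mul_left (by omega) h3

theorem no_commuting_involution (H : RealSemiregular L N) {t y : L} (ht : t * t = 1) (ht1 : t ≠ 1)
    (hy : OddInverted t y) {v : L} (hv : v * v = 1) (hv1 : v ≠ 1) (hvy : Commute v y) : False := by
  obtain ⟨x, hx, hyx, hmax⟩ := H.exists_maximal ht1 hy
  have h1 : orderOf y ∣ Nat.card (fixedSubgroup N t) + 1 := by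
    rw [← H.orderOf_eq ht ht1 hx hmax]
    exact orderOf_dvd_of_mem_zpowers hyx
  have h2 : orderOf y ∣ Nat.card (fixedSubgroup N v) - 1 := by
    refine orderOf_dvd_card_sub_one ?_ ?_
    · intro n hn
      change v • y • n = y • n
      rw [← mul_smul, hvy.eq, mul_smul, hn]
    · intro a ha hne n hn
      exact H.free t a (hy.of_mem_zpowers ha hne) n hn
  have h3 := H.one_lt_card_fixedSubgroup ht ht1
  rw [H.card_fixedSubgroup_eq hv hv1 ht ht1] at h2
  have h4 := Nat.dvd_sub h1 h2
  have h5 : Nat.card (fixedSubgroup N t) + 1 - (Nat.card (fixedSubgroup N t) - 1) = 2 := by omega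
  rw [h5] at h4
  have h6 := Nat.Coprime.eq_one_of_dvd (Nat.coprime_two_right.2 hy.odd) h4
  exact hy.ne_one (orderOf_eq_one_iff.1 h6)

theorem odd_orderOf_of_commute (H : RealSemiregular L N) {t y : L} (ht : t * t = 1) (ht1 : t ≠ 1)
    (hy : OddInverted t y) {w : L} (hwy : Commute w y) : Odd (orderOf w) := by
  by_contra ho
  rw [Nat.not_odd_iff_even, even_iff_two_dvd] at ho
  obtain ⟨m, hm⟩ := ho
  have hpos := orderOf_pos w
  refine H.no_commuting_involution ht ht1 hy (v := w ^ m) ?_ ?_ (hwy.pow_left m)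
  · rw [← pow_add, ← two_mul, ← hm, pow_orderOf_eq_one]
  · exact pow_ne_one_of_lt_orderOf (by omega) (by omega)

end RealSemiregular

theorem exists_fixed_of_not_dvd_card {α : Type*} [Finite α] {p : ℕ} (hp : p.Prime) {f : α → α}
    {k : ℕ} (hf : f^[p ^ k] = id) (h : ¬ p ∣ Nat.card α) : ∃ a, f a = a := by
  classical
  have := Fintype.ofFinite α
  have : Fact p.Prime := ⟨hp⟩
  let f' : Function.End α := f
  have h1 : f' ^ p ^ k = 1 := hf
  have h2 := Equiv.Perm.card_fixedPoints_modEq h1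
  by_contra! hc
  have h3 : Fintype.card (Function.fixedPoints f) = 0 := by
    rw [Fintype.card_eq_zero_iff]
    exact ⟨fun a => hc a.1 a.2⟩
  rw [Nat.card_eq_fintype_card] at h
  exact h ((Nat.modEq_zero_iff_dvd).1 (h2.trans (by rw [h3])))

theorem exists_fixed_of_odd_card {α : Type*} [Finite α] {f : α → α} {k : ℕ}
    (hf : f^[2 ^ k] = id) (h : Odd (Nat.card α)) : ∃ a, f a = a := by
  apply exists_fixed_of_not_dvd_card Nat.prime_two hf
  rwa [← even_iff_two_dvd, Nat.not_even_iff_odd]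

theorem even_card_of_involutive {α : Type*} [Finite α] {f : α → α} (hf : ∀ a, f (f a) = a)
    (hne : ∀ a, f a ≠ a) : Even (Nat.card α) := by
  by_contra h
  rw [Nat.not_even_iff_odd] at h
  obtain ⟨a, ha⟩ := exists_fixed_of_odd_card (f := f) (k := 1) (by funext a; exact hf a) h
  exact hne a ha

theorem mem_of_odd_index {L : Type*} [Group L] [Finite L] {M K : Subgroup L} (hKM : K ≤ M)
    (hK : Odd K.index) {v : L} (hv : v * v = 1) (hvM : v ∈ M)
    (h : ∀ y ∈ M, OddInverted v y → False) : v ∈ K := by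
  by_contra hvK
  have h1 : Odd (K.subgroupOf M).index :=
    Odd.of_dvd_nat hK (Dvd.intro _ (Subgroup.relIndex_mul_index hKM))
  obtain ⟨g, j, h2, h3, h4⟩ := exists_odd_inverted (t := (⟨v, hvM⟩ : M)) (Subtype.ext hv) h1 hvK
  set y : M := (⟨v, hvM⟩ * (g * ⟨v, hvM⟩ * g⁻¹)) ^ j with hy
  refine h y y.2 ⟨fun h => h2 (Subtype.ext h), ?_, congrArg Subtype.val h4⟩
  rw [Subgroup.orderOf_coe]
  exact h3

theorem commute_of_inverted_of_inverted {L : Type*} [Group L] {s t y : L}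
    (hs : s * y * s⁻¹ = y⁻¹) (ht : t * y * t⁻¹ = y⁻¹) : Commute (s * t) y := by
  have h1 : s * y⁻¹ * s⁻¹ = y := by rw [← conj_inv, hs, inv_inv]
  have h2 : (s * t) * y * (s * t)⁻¹ = y := by
    have : (s * t) * y * (s * t)⁻¹ = s * (t * y * t⁻¹) * s⁻¹ := by group
    rw [this, ht, h1]
  exact mul_inv_eq_iff_eq_mul.1 h2

namespace RealSemiregular

variable {L N : Type*} [Group L] [Finite L] [Group N] [Finite N] [MulDistribMulAction L N]

theorem mem_zpowers_of_commute (H : RealSemiregular L N) {t x : L} (ht : t * t = 1) (ht1 : t ≠ 1)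
    (hx : OddInverted t x) (hmax : ∀ w, OddInverted t w → Commute x w → w ∈ Subgroup.zpowers x)
    {y : L} (hy : y ∈ Subgroup.zpowers x) (hy1 : y ≠ 1) {w : L} (hwy : Commute w y)
    (hw : t * w * t⁻¹ = w⁻¹) : w ∈ Subgroup.zpowers x := by
  have hyt := hx.of_mem_zpowers hy hy1
  set I : Set L := {w | Commute w y ∧ t * w * t⁻¹ = w⁻¹} with hI
  have hsub : (Subgroup.zpowers x : Set L) ⊆ I := by
    intro a ha
    refine ⟨?_, conj_eq_inv_of_mem_zpowers hx.conj ha⟩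
    obtain ⟨i, rfl⟩ := ha
    obtain ⟨j, rfl⟩ := hy
    exact (Commute.refl x).zpow_zpow i j
  have hinv : ∀ a : I, t * (a : L) * (t * a) = 1 := fun a => mul_inverted_mul_self ht a.2.2
  have hne : ∀ a : I, t * (a : L) ≠ 1 := fun a =>
    mul_inverted_ne_one ht ht1 (H.odd_orderOf_of_commute ht ht1 hyt a.2.1)
  have h1 := (card_mul_add_one_le (fun a : I => fixedSubgroup N (t * (a : L)))
    (fun a => H.card_fixedSubgroup_eq (hinv a) (hne a) ht ht1) (by
      intro a b hab n ha hb
      have hab' : ((a : L)⁻¹ * b) = (t * a) * (t * b) := by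
        rw [← inv_eq_of_mul_eq_one_left (hinv a)]; group
      refine H.free (t * (a : L)) ((a : L)⁻¹ * b) ⟨?_, ?_, ?_⟩ n ?_
      · intro h
        exact hab (Subtype.ext (inv_mul_eq_one.1 h))
      · exact H.odd_orderOf_of_commute ht ht1 hyt (a.2.1.inv_left.mul_left b.2.1)
      · rw [hab']; exact conj_involution_mul (hinv a) (hinv b)
      · change (t * (a : L)) • n = n at ha
        change (t * (b : L)) • n = n at hb
        rw [hab', mul_smul, hb, ha])).1
  rw [← H.card_fixedSubgroup_mul_self ht ht1] at h1
  have h2 := H.one_lt_card_fixedSubgroup ht ht1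
  have h4 := H.orderOf_eq ht ht1 hx hmax
  obtain ⟨m, hm⟩ : ∃ m, Nat.card (fixedSubgroup N t) = m + 2 := ⟨_, (Nat.sub_add_cancel h2).symm⟩
  rw [hm] at h1 h4
  have h3 : Nat.card I * (m + 1) ≤ (m + 2 + 1) * (m + 1) := by
    have : m + 2 - 1 = m + 1 := rfl
    rw [this] at h1
    linarith
  have h5 := Nat.le_of_mul_le_mul_right h3 (by omega)
  have h6 : (Subgroup.zpowers x : Set L) = I := by
    refine Set.eq_of_subset_of_ncard_le hsub ?_
    have h7 : (Subgroup.zpowers x : Set L).ncard = orderOf x := Nat.card_zpowers x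
    rw [h7, h4]
    exact h5
  have : w ∈ I := ⟨hwy, hw⟩
  rw [← h6] at this
  exact this

theorem two_element_or_odd (H : RealSemiregular L N) {u v : L} (hu : u * u = 1) (hv : v * v = 1) :
    (∃ k : ℕ, (u * v) ^ 2 ^ k = 1) ∨ Odd (orderOf (u * v)) := by
  obtain ⟨k, hk⟩ := exists_pow_two_pow_odd_orderOf (u * v)
  by_cases h1 : (u * v) ^ 2 ^ k = 1
  · exact Or.inl ⟨k, h1⟩
  · right
    by_cases hu1 : u = 1
    · subst hu1
      exfalso
      apply h1
      apply odd_order_of_mul_self _ hk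
      rw [one_mul, ← (Commute.refl v).mul_pow, hv, one_pow]
    · refine H.odd_orderOf_of_commute hu hu1 (y := (u * v) ^ 2 ^ k) ⟨h1, hk, ?_⟩
        ((Commute.refl _).pow_right _)
      rw [← conj_pow, conj_involution_mul hu hv, inv_pow]

theorem smul_eq_iff_commute (H : RealSemiregular L N) (S : Sylow 2 L) {s : L}
    (hs : s * s = 1) (hs1 : s ≠ 1) (hsc : ∀ a ∈ S, Commute a s) {n : N} (hn : n ≠ 1)
    (hsn : s • n = n) {v : L} (hv : v * v = 1) : v • n = n ↔ Commute v s := by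
  obtain ⟨S₁, hS₁⟩ := exists_sylow_le_of_odd_index (H.stab n)
  obtain ⟨g, rfl⟩ := MulAction.exists_smul_eq L S S₁
  have hg : ∀ a ∈ S, a • g⁻¹ • n = g⁻¹ • n := by
    intro a ha
    have h1 : MulAut.conj g • a ∈ ((g • S : Sylow 2 L) : Subgroup L) := by
      rw [Sylow.coe_subgroup_smul]
      exact Subgroup.smul_mem_pointwise_smul _ (MulAut.conj g) _ ha
    have h2 : (g * a * g⁻¹) • n = n := hS₁ h1
    rw [mul_smul, mul_smul] at h2
    exact eq_inv_smul_iff.2 h2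
  obtain ⟨y, hy⟩ := H.exists_oddInverted hs hs1
  obtain ⟨d, hdy, hd⟩ := H.trans s y hy (g⁻¹ • n) g
  rw [smul_inv_smul] at hd
  set D : Subgroup L := (S : Subgroup L).map (MulAut.conj d).toMonoidHom with hD
  have hDodd : Odd D.index :=
    Odd.of_dvd_nat S.odd_index (Subgroup.index_map_dvd _ (MulAut.conj d).surjective)
  have hDn : D ≤ MulAction.stabilizer L n := by
    rintro _ ⟨a, ha, rfl⟩
    change (d * a * d⁻¹) • n = n
    rw [← hd, mul_smul, mul_smul, inv_smul_smul, hg a ha]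
  have hstab : ∀ v : L, v * v = 1 → v • n = n → v ∈ D := by
    intro v hv hvn
    refine mem_of_odd_index hDn hDodd hv hvn ?_
    intro y hy hvy
    exact hn (H.free v y hvy n hy)
  have hds : d * s * d⁻¹ = s := by
    obtain ⟨a, ha, has⟩ := hstab s hs hsn
    change d * a * d⁻¹ = s at has
    have hc : Commute s (d * s * d⁻¹) := by
      have h3 := (Commute.conj_iff d).2 (hsc a ha)
      rwa [has] at h3
    by_contra hne
    have hdsinv : (d * s * d⁻¹) * y * (d * s * d⁻¹)⁻¹ = y⁻¹ := by
      have h5 : (d * s * d⁻¹) * y * (d * s * d⁻¹)⁻¹ = d * (s * (d⁻¹ * y * d) * s⁻¹) * d⁻¹ := by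
        group
      have h6 : d⁻¹ * y * d = y := by rw [mul_assoc, ← hdy.eq, inv_mul_cancel_left]
      rw [h5, h6, hy.conj, hdy.inv_right.eq, mul_inv_cancel_right]
    refine H.no_commuting_involution hs hs1 hy (v := s * (d * s * d⁻¹)) ?_ ?_
      (commute_of_inverted_of_inverted hy.conj hdsinv)
    · rw [hc.symm.mul_mul_mul_comm, hs, conj_conj_self hs, one_mul]
    · intro h
      apply hne
      rw [← inv_eq_of_mul_eq_one_right h, inv_eq_of_mul_eq_one_left hs]
  have hDs : ∀ b ∈ D, Commute b s := by
    rintro _ ⟨a, ha, rfl⟩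
    change Commute (d * a * d⁻¹) s
    rw [← hds]
    exact (Commute.conj_iff d).2 (hsc a ha)
  constructor
  · intro hvn
    exact hDs v (hstab v hv hvn)
  · intro hvs
    have hle : D ≤ Subgroup.centralizer {s} := by
      intro b hb
      rw [Subgroup.mem_centralizer_singleton_iff]
      exact (hDs b hb).eq
    refine hDn (mem_of_odd_index hle hDodd hv
      (Subgroup.mem_centralizer_singleton_iff.2 hvs.eq) ?_)
    intro z hz hvz
    rw [Subgroup.mem_centralizer_singleton_iff] at hz
    have hv1 : v ≠ 1 := by
      rintro rfl
      apply hvz.ne_one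
      apply odd_order_of_mul_self _ hvz.odd
      have := hvz.conj
      rw [one_mul, inv_one, mul_one] at this
      exact mul_eq_one_iff_eq_inv.2 this
    exact H.no_commuting_involution hv hv1 hvz hs hs1 (Commute.symm hz)

end RealSemiregular

namespace RealSemiregular

variable {L N : Type*} [Group L] [Finite L] [Group N] [Finite N] [MulDistribMulAction L N]

theorem exists_ne_one_smul_eq (H : RealSemiregular L N) {v : L} (hv : v * v = 1) (hv1 : v ≠ 1) :
    ∃ n : N, n ≠ 1 ∧ v • n = n := by
  have h1 := H.one_lt_card_fixedSubgroup hv hv1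
  rw [Subgroup.one_lt_card_iff_ne_bot, Subgroup.ne_bot_iff_exists_ne_one] at h1
  obtain ⟨⟨n, hn⟩, hne⟩ := h1
  exact ⟨n, fun h => hne (Subtype.ext h), hn⟩

theorem exists_conj_commute (H : RealSemiregular L N) (S : Sylow 2 L) {s : L}
    (hs : s * s = 1) (hs1 : s ≠ 1) (hsc : ∀ a ∈ S, Commute a s) {x : L} (hx : OddInverted s x)
    (hmax : ∀ w, OddInverted s w → Commute x w → w ∈ Subgroup.zpowers x) {v : L} (hv : v * v = 1)
    (hv1 : v ≠ 1) : ∃ z ∈ Subgroup.zpowers x, Commute (z * v * z⁻¹) s := by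
  obtain ⟨n, hn, hvn⟩ := H.exists_ne_one_smul_eq hv hv1
  obtain ⟨a, ha, han⟩ := H.exists_mul_smul_eq hs hx hmax n
  obtain ⟨z, hz, rfl⟩ := exists_mul_self_eq_of_odd (odd_orderOf_of_mem_zpowers hx.odd ha)
  have hzx : z ∈ Subgroup.zpowers x := Subgroup.zpowers_le.2 ha hz
  rw [mul_inverted_eq_conj (conj_eq_inv_of_mem_zpowers hx.conj hzx), inv_inv, mul_smul,
    mul_smul, inv_smul_eq_iff] at han
  refine ⟨z, hzx, ?_⟩
  refine (H.smul_eq_iff_commute S hs hs1 hsc (n := z • n) ?_ han (conj_conj_self hv)).1 ?_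
  · intro h
    rw [smul_eq_iff_eq_inv_smul, smul_one] at h
    exact hn h
  · rw [mul_smul, mul_smul, inv_smul_smul, hvn]

theorem card_involutions (H : RealSemiregular L N) (S : Sylow 2 L) {s : L}
    (hs : s * s = 1) (hs1 : s ≠ 1) (hsc : ∀ a ∈ S, Commute a s) {x : L} (hx : OddInverted s x)
    (hmax : ∀ w, OddInverted s w → Commute x w → w ∈ Subgroup.zpowers x) :
    Nat.card {v : L // v * v = 1 ∧ v ≠ 1} =
      orderOf x * Nat.card {v : L // (v * v = 1 ∧ v ≠ 1) ∧ Commute v s} := by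
  let f : Subgroup.zpowers x × {v : L // (v * v = 1 ∧ v ≠ 1) ∧ Commute v s} →
      {v : L // v * v = 1 ∧ v ≠ 1} := fun p => ⟨(p.1 : L)⁻¹ * p.2 * p.1, by
    have h1 := conj_conj_self (g := (p.1 : L)⁻¹) p.2.2.1.1
    rwa [inv_inv] at h1, by
    intro h
    apply p.2.2.1.2
    have h2 : (p.2 : L) = p.1 * ((p.1 : L)⁻¹ * p.2 * p.1) * (p.1 : L)⁻¹ := by group
    rw [h2, h, mul_one, mul_inv_cancel]⟩
  have hf : Function.Bijective f := by
    constructor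
    · rintro ⟨⟨z, hz⟩, ⟨v, hv, hvs⟩⟩ ⟨⟨z', hz'⟩, ⟨v', hv', hvs'⟩⟩ he
      have he' : z⁻¹ * v * z = z'⁻¹ * v' * z' := congrArg Subtype.val he
      have hc : ∀ {z v : L}, z ∈ Subgroup.zpowers x → Commute v s →
          Commute (z⁻¹ * v * z) (s * (z * z)) := by
        intro z v hz hvs
        rw [mul_inverted_eq_conj (conj_eq_inv_of_mem_zpowers hx.conj hz)]
        have := (Commute.conj_iff z⁻¹).2 hvs
        rwa [inv_inv] at this ⊢
      have h1 := hc hz hvs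
      have h2 := hc hz' hvs'
      rw [← he'] at h2
      have h3 := h1.mul_right h2
      have h4 : s * (z * z) * (s * (z' * z')) = (z * z)⁻¹ * (z' * z') := by
        rw [← conj_eq_inv_of_mem_zpowers hx.conj (mul_mem hz hz), inv_eq_of_mul_eq_one_left hs]
        group
      rw [h4] at h3
      have h5 : (z * z)⁻¹ * (z' * z') = 1 := by
        by_contra hne
        refine H.no_commuting_involution hs hs1 (hx.of_mem_zpowers (mul_mem (inv_mem (mul_mem hz hz))
          (mul_mem hz' hz')) hne) (f ⟨⟨z, hz⟩, ⟨v, hv, hvs⟩⟩).2.1 (f ⟨⟨z, hz⟩, ⟨v, hv, hvs⟩⟩).2.2 h3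
      have h6 : z = z' := by
        rw [← inv_mul_eq_one]
        apply odd_order_of_mul_self _ (odd_orderOf_of_mem_zpowers hx.odd (mul_mem (inv_mem hz) hz'))
        have hcomm : Commute z z' := by
          obtain ⟨i, rfl⟩ := hz
          obtain ⟨j, rfl⟩ := hz'
          exact (Commute.refl x).zpow_zpow i j
        rw [← h5, hcomm.symm.inv_right.mul_mul_mul_comm, mul_inv_rev]
      subst h6
      have h7 : v = v' := by
        have := mul_left_cancel (mul_right_cancel he')
        exact this
      subst h7
      rfl
    · rintro ⟨v, hv, hv1⟩
      obtain ⟨z, hz, hc⟩ := H.exists_conj_commute S hs hs1 hsc hx hmax hv hv1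
      refine ⟨⟨⟨z, hz⟩, ⟨z * v * z⁻¹, ⟨conj_conj_self hv, ?_⟩, hc⟩⟩, Subtype.ext ?_⟩
      · intro h
        rw [mul_inv_eq_one] at h
        exact hv1 (mul_eq_left.1 h)
      · change z⁻¹ * (z * v * z⁻¹) * z = v
        group
  rw [← Nat.card_congr (Equiv.ofBijective f hf), Nat.card_prod, Nat.card_zpowers]

theorem odd_card_commuting_involutions {s : L} (hs : s * s = 1) (hs1 : s ≠ 1) :
    Odd (Nat.card {v : L // (v * v = 1 ∧ v ≠ 1) ∧ Commute v s}) := by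
  have h1 : Even (Nat.card {v : L // v * v = 1 ∧ Commute v s}) := by
    refine even_card_of_involutive (f := fun v => ⟨s * v, ?_, ?_⟩) ?_ ?_
    · rw [v.2.2.mul_mul_mul_comm, hs, v.2.1, one_mul]
    · exact (Commute.refl s).mul_left v.2.2
    · rintro ⟨v, hv⟩
      apply Subtype.ext
      change s * (s * v) = v
      rw [← mul_assoc, hs, one_mul]
    · rintro ⟨v, hv⟩ h
      exact hs1 (mul_eq_right.1 (congrArg Subtype.val h))
  have h2 := Set.ncard_sdiff_singleton_add_one (s := {v : L | v * v = 1 ∧ Commute v s}) (a := 1)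
    ⟨by simp, Commute.one_left s⟩
  have h3 : {v : L | v * v = 1 ∧ Commute v s} \ {1} =
      {v : L | (v * v = 1 ∧ v ≠ 1) ∧ Commute v s} := by
    ext v
    simp only [Set.mem_sdiff, Set.mem_ofPred_eq, Set.mem_singleton_iff]
    tauto
  rw [h3] at h2
  have h4 : Even ({v : L | v * v = 1 ∧ Commute v s}.ncard) := h1
  have h5 : ¬ Even ({v : L | (v * v = 1 ∧ v ≠ 1) ∧ Commute v s}.ncard) := by
    rw [← h2] at h4
    intro h
    exact (Nat.even_add_one.1 h4) h
  exact Nat.not_even_iff_odd.1 h5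

end RealSemiregular

namespace RealSemiregular

variable {L N : Type*} [Group L] [Finite L] [Group N] [Finite N] [MulDistribMulAction L N]

theorem commute_of_two_element (H : RealSemiregular L N) (S : Sylow 2 L) {s : L}
    (hs : s * s = 1) (hs1 : s ≠ 1) (hsc : ∀ a ∈ S, Commute a s) {v : L} (hv : v * v = 1) {k : ℕ}
    (hk : (s * v) ^ 2 ^ k = 1) : Commute v s := by
  have : Fact (Nat.Prime 2) := ⟨Nat.prime_two⟩
  have h1 := isPGroup_closure_pair hs hv hk
  have h2 : 2 ∣ Nat.card N := by
    obtain ⟨n, hn, -⟩ := H.exists_ne_one_smul_eq hs hs1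
    have h3 := orderOf_eq_prime (p := 2) (by rw [pow_two, H.two n]) hn
    rw [← h3]
    exact orderOf_dvd_natCard n
  obtain ⟨n, hn, hne⟩ := h1.exists_fixed_point_of_prime_dvd_card_of_fixed_point N h2 (a := 1)
    (fun g => smul_one _)
  have hsn : s • n = n := hn ⟨s, Subgroup.subset_closure (by simp)⟩
  have hvn : v • n = n := hn ⟨v, Subgroup.subset_closure (by simp)⟩
  exact (H.smul_eq_iff_commute S hs hs1 hsc (Ne.symm hne) hsn hv).1 hvn

theorem oddInverted_mul (H : RealSemiregular L N) (S : Sylow 2 L) {s : L}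
    (hs : s * s = 1) (hs1 : s ≠ 1) (hsc : ∀ a ∈ S, Commute a s) {v : L} (hv : v * v = 1)
    (hvs : ¬ Commute v s) : OddInverted s (s * v) := by
  refine ⟨?_, ?_, conj_involution_mul hs hv⟩
  · intro h
    apply hvs
    rw [← inv_eq_of_mul_eq_one_right h]
    exact (Commute.refl s).inv_left
  · rcases H.two_element_or_odd hs hv with ⟨k, hk⟩ | h
    · exact absurd (H.commute_of_two_element S hs hs1 hsc hv hk) hvs
    · exact h

theorem card_involutions_eq_add (H : RealSemiregular L N) (S : Sylow 2 L) {s : L}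
    (hs : s * s = 1) (hs1 : s ≠ 1) (hsc : ∀ a ∈ S, Commute a s) :
    Nat.card {v : L // v * v = 1 ∧ v ≠ 1} =
      Nat.card {v : L // (v * v = 1 ∧ v ≠ 1) ∧ Commute v s} +
      Nat.card {w : L // OddInverted s w} := by
  have h1 := Set.ncard_inter_add_ncard_sdiff_eq_ncard {v : L | v * v = 1 ∧ v ≠ 1}
    {v : L | Commute v s} (Set.toFinite _)
  have h2 : Nat.card {w : L // OddInverted s w} =
      ({v : L | v * v = 1 ∧ v ≠ 1} \ {v : L | Commute v s}).ncard := by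
    have h3 : {v : L | v * v = 1 ∧ v ≠ 1} \ {v : L | Commute v s} =
        (fun w => s * w) '' {w : L | OddInverted s w} := by
      ext v
      constructor
      · rintro ⟨⟨hv, hv1⟩, hvs⟩
        refine ⟨s * v, H.oddInverted_mul S hs hs1 hsc hv hvs, ?_⟩
        change s * (s * v) = v
        rw [← mul_assoc, hs, one_mul]
      · rintro ⟨w, hw, rfl⟩
        refine ⟨⟨mul_inverted_mul_self hs hw.conj, mul_inverted_ne_one hs hs1 hw.odd⟩, ?_⟩
        intro h
        apply hw.ne_one
        apply odd_order_of_mul_self _ hw.odd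
        have h4 : Commute w s := by
          have h5 : Commute (s⁻¹ * (s * w)) s := (Commute.refl s).inv_left.mul_left h
          rwa [inv_mul_cancel_left] at h5
        have h5 := hw.conj
        rw [← h4.eq, mul_inv_cancel_right] at h5
        exact mul_eq_one_iff_eq_inv.2 h5
    rw [h3, Set.ncard_image_of_injective _ (mul_right_injective s)]
    rfl
  rw [h2]
  exact h1.symm

theorem card_commute_class (H : RealSemiregular L N) {s : L} (hs : s * s = 1) (hs1 : s ≠ 1) {w : L}
    (hw : OddInverted s w) : Nat.card {w' : L // OddInverted s w' ∧ Commute w' w} =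
      Nat.card (fixedSubgroup N s) := by
  obtain ⟨x, hx, hwx, hmax⟩ := H.exists_maximal hs1 hw
  have h1 : {w' : L | OddInverted s w' ∧ Commute w' w} = (Subgroup.zpowers x : Set L) \ {1} := by
    ext w'
    constructor
    · rintro ⟨h1, h2⟩
      exact ⟨H.mem_zpowers_of_commute hs hs1 hx hmax hwx hw.ne_one h2 h1.conj, h1.ne_one⟩
    · rintro ⟨h1, h2⟩
      refine ⟨hx.of_mem_zpowers h1 h2, ?_⟩
      obtain ⟨i, rfl⟩ := h1
      obtain ⟨j, rfl⟩ := hwx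
      exact (Commute.refl x).zpow_zpow i j
  have h2 := Set.ncard_sdiff_singleton_add_one (s := (Subgroup.zpowers x : Set L)) (one_mem _)
  rw [← h1] at h2
  have h3 : (Subgroup.zpowers x : Set L).ncard = orderOf x := Nat.card_zpowers x
  rw [h3, H.orderOf_eq hs hs1 hx hmax] at h2
  exact Nat.succ_injective h2

theorem commute_trans_of_inverted (H : RealSemiregular L N) {s : L} (hs : s * s = 1) (hs1 : s ≠ 1)
    {a b c : L} (ha : OddInverted s a) (hb : OddInverted s b) (hc : OddInverted s c)
    (hab : Commute a b) (hbc : Commute b c) : Commute a c := by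
  obtain ⟨x, hx, hbx, hmax⟩ := H.exists_maximal hs1 hb
  obtain ⟨i, rfl⟩ := H.mem_zpowers_of_commute hs hs1 hx hmax hbx hb.ne_one hab ha.conj
  obtain ⟨j, rfl⟩ := H.mem_zpowers_of_commute hs hs1 hx hmax hbx hb.ne_one hbc.symm hc.conj
  exact (Commute.refl x).zpow_zpow i j

/-- Commuting is an equivalence relation on the odd order elements inverted by an involution. -/
def commuteSetoid (H : RealSemiregular L N) {s : L} (hs : s * s = 1) (hs1 : s ≠ 1) :
    Setoid {w : L // OddInverted s w} where
  r a b := Commute (a : L) b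
  iseqv := ⟨fun a => Commute.refl (a : L), fun h => Commute.symm h,
    fun {a b c} h h' => H.commute_trans_of_inverted hs hs1 a.2 b.2 c.2 h h'⟩

theorem card_inverted (H : RealSemiregular L N) {s : L} (hs : s * s = 1) (hs1 : s ≠ 1) :
    Nat.card {w : L // OddInverted s w} =
      Nat.card (Quotient (H.commuteSetoid hs hs1)) * Nat.card (fixedSubgroup N s) := by
  let r := H.commuteSetoid hs hs1
  have : Fintype (Quotient r) := Fintype.ofFinite _
  rw [← Nat.card_congr (Equiv.sigmaFiberEquiv (Quotient.mk r)), Nat.card_sigma]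
  rw [Finset.sum_const_nat (m := Nat.card (fixedSubgroup N s)),
    Finset.card_univ, ← Nat.card_eq_fintype_card]
  intro q _
  induction q using Quotient.inductionOn with
  | h w =>
    rw [← H.card_commute_class hs hs1 w.2]
    refine Nat.card_congr ⟨fun a => ⟨a.1.1, a.1.2, Quotient.exact a.2⟩,
      fun a => ⟨⟨a.1, a.2.1⟩, Quotient.sound a.2.2⟩, fun a => rfl, fun a => rfl⟩

theorem odd_card_quotient (H : RealSemiregular L N) (S : Sylow 2 L) {s : L}
    (hs : s * s = 1) (hs1 : s ≠ 1) (hsc : ∀ a ∈ S, Commute a s) :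
    Odd (Nat.card (Quotient (H.commuteSetoid hs hs1))) := by
  have h1 := H.card_involutions_eq_add S hs hs1 hsc
  obtain ⟨y, hy⟩ := H.exists_oddInverted hs hs1
  obtain ⟨x, hx, -, hmax⟩ := H.exists_maximal hs1 hy
  rw [H.card_involutions S hs hs1 hsc hx hmax, H.orderOf_eq hs hs1 hx hmax, add_mul, one_mul,
    add_comm, H.card_inverted hs hs1] at h1
  have h2 := Nat.add_left_cancel h1
  rw [mul_comm] at h2
  have h3 := H.one_lt_card_fixedSubgroup hs hs1
  rw [← Nat.eq_of_mul_eq_mul_right (by omega) h2]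
  exact odd_card_commuting_involutions hs hs1

theorem eq_of_commute_involution (H : RealSemiregular L N) (S : Sylow 2 L) {s : L}
    (hs : s * s = 1) (hs1 : s ≠ 1) (hsc : ∀ a ∈ S, Commute a s) {u : L} (hu : u * u = 1)
    (hu1 : u ≠ 1) (hus : Commute u s) : u = s := by
  by_contra hne
  let r := H.commuteSetoid hs hs1
  have hu' : u⁻¹ = u := inv_eq_of_mul_eq_one_left hu
  have hc : ∀ w : L, OddInverted s w → OddInverted s (u * w * u⁻¹) := by
    intro w hw
    refine ⟨?_, ?_, ?_⟩
    · intro h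
      rw [mul_inv_eq_one] at h
      exact hw.ne_one (mul_eq_left.1 h)
    · have : orderOf (u * w * u⁻¹) = orderOf w :=
        orderOf_injective (MulAut.conj u).toMonoidHom (MulAut.conj u).injective w
      rw [this]
      exact hw.odd
    · have : s * (u * w * u⁻¹) * s⁻¹ = u * (s * w * s⁻¹) * u⁻¹ := by
        have h1 : s * (u * w * u⁻¹) * s⁻¹ = (s * u) * w * (s * u)⁻¹ := by group
        rw [h1, ← hus.eq]; group
      rw [this, hw.conj, conj_inv]
  let f : Quotient r → Quotient r := Quotient.map (fun w => ⟨u * w * u⁻¹, hc w w.2⟩) (by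
    intro a b hab
    exact (Commute.conj_iff u).2 hab)
  obtain ⟨q, hq⟩ := exists_fixed_of_odd_card (f := f) (k := 1) (by
    funext q
    induction q using Quotient.inductionOn with
    | h w =>
      change Quotient.mk r _ = Quotient.mk r w
      congr 1
      apply Subtype.ext
      change u * (u * w * u⁻¹) * u⁻¹ = w
      have : u * (u * w * u⁻¹) * u⁻¹ = (u * u) * w * (u * u)⁻¹ := by group
      rw [this, hu]
      group) (H.odd_card_quotient S hs hs1 hsc)
  induction q using Quotient.inductionOn with
  | h w =>
    obtain ⟨w, hw⟩ := w
    have hcomm : Commute (u * w * u⁻¹) w := Quotient.exact hq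
    obtain ⟨x, hx, hwx, hmax⟩ := H.exists_maximal hs1 hw
    have h1 := H.mem_zpowers_of_commute hs hs1 hx hmax hwx hw.ne_one hcomm (hc w hw).conj
    have h2 : Commute u (w * (u * w * u⁻¹)) := by
      have h3 : u * (w * (u * w * u⁻¹)) * u⁻¹ = w * (u * w * u⁻¹) := by
        have : u * (w * (u * w * u⁻¹)) * u⁻¹ = (u * w * u⁻¹) * ((u * u) * w * (u * u)⁻¹) := by group
        rw [this, hu, inv_one, mul_one, one_mul, hcomm.eq]
      exact mul_inv_eq_iff_eq_mul.1 h3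
    have h3 : w * (u * w * u⁻¹) = 1 := by
      by_contra hne
      exact H.no_commuting_involution hs hs1 (hx.of_mem_zpowers (mul_mem hwx h1) hne) hu hu1 h2
    have h4 : u * w * u⁻¹ = w⁻¹ := (inv_eq_of_mul_eq_one_right h3).symm
    refine H.no_commuting_involution hs hs1 hw (v := u * s) ?_ ?_
      (commute_of_inverted_of_inverted h4 hw.conj)
    · rw [hus.symm.mul_mul_mul_comm, hu, hs, one_mul]
    · intro h
      apply hne
      rw [← inv_eq_of_mul_eq_one_right h, hu']

theorem involution_mem (H : RealSemiregular L N) (S : Sylow 2 L) {s : L}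
    (hs : s * s = 1) (hs1 : s ≠ 1) (hsc : ∀ a ∈ S, Commute a s) {x : L} (hx : OddInverted s x)
    (hmax : ∀ w, OddInverted s w → Commute x w → w ∈ Subgroup.zpowers x) {v : L} (hv : v * v = 1)
    (hv1 : v ≠ 1) : ∃ a ∈ Subgroup.zpowers x, v = s * a := by
  obtain ⟨z, hz, hc⟩ := H.exists_conj_commute S hs hs1 hsc hx hmax hv hv1
  have h1 := H.eq_of_commute_involution S hs hs1 hsc (conj_conj_self hv) (by
    intro h
    rw [mul_inv_eq_one] at h
    exact hv1 (mul_eq_left.1 h)) hc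
  refine ⟨z * z, mul_mem hz hz, ?_⟩
  rw [mul_inverted_eq_conj (conj_eq_inv_of_mem_zpowers hx.conj hz), ← h1]
  group

end RealSemiregular

theorem eq_one_of_mul_eq_mul_self {h c e : ℕ} (hh : 1 < h) (hc : 1 < c) (hd : h + 1 ∣ c - 1)
    (hce : c * e = h * h) : e = 1 := by
  obtain ⟨k, hk⟩ := hd
  obtain ⟨c, rfl⟩ : ∃ c', c = c' + 1 := ⟨c - 1, by omega⟩
  obtain ⟨h, rfl⟩ : ∃ h', h = h' + 1 := ⟨h - 1, by omega⟩
  rw [Nat.add_sub_cancel] at hk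
  subst hk
  have he : e ≠ 0 := by
    rintro rfl
    rw [mul_zero] at hce
    nlinarith
  obtain ⟨e, rfl⟩ : ∃ e', e = e' + 1 := ⟨e - 1, by omega⟩
  have h1 : h + 1 + 1 ∣ e := by
    have h2 : (h + 1 + 1) * h = (h + 1 + 1) * (k * (e + 1)) + e := by linarith
    exact (Nat.dvd_add_right (Dvd.intro _ rfl)).1 (h2 ▸ Dvd.intro _ rfl)
  obtain ⟨m, rfl⟩ := h1
  rcases Nat.eq_zero_or_pos m with rfl | hm
  · rfl
  · rcases Nat.eq_zero_or_pos k with rfl | hk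
    · omega
    · exfalso
      have h3 : h + 1 + 1 ≤ (h + 1 + 1) * k := Nat.le_mul_of_pos_right _ hk
      have h4 : h + 1 + 1 ≤ (h + 1 + 1) * m := Nat.le_mul_of_pos_right _ hm
      nlinarith

namespace RealSemiregular

variable {L N : Type*} [Group L] [Finite L] [Group N] [Finite N] [MulDistribMulAction L N]

theorem zpowers_normal (H : RealSemiregular L N) (S : Sylow 2 L) {s : L}
    (hs : s * s = 1) (hs1 : s ≠ 1) (hsc : ∀ a ∈ S, Commute a s) {x : L} (hx : OddInverted s x)
    (hmax : ∀ w, OddInverted s w → Commute x w → w ∈ Subgroup.zpowers x) :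
    (Subgroup.zpowers x).Normal := by
  have hgx : ∀ g : L, g * x * g⁻¹ ∈ Subgroup.zpowers x := by
    intro g
    have hne : ∀ v : L, v ≠ 1 → g * v * g⁻¹ ≠ 1 := by
      intro v hv h
      rw [mul_inv_eq_one] at h
      exact hv (mul_eq_left.1 h)
    obtain ⟨a, ha, h1⟩ := H.involution_mem S hs hs1 hsc hx hmax (conj_conj_self hs (g := g))
      (hne s hs1)
    obtain ⟨b, hb, h2⟩ := H.involution_mem S hs hs1 hsc hx hmax
      (conj_conj_self (mul_inverted_mul_self hs hx.conj) (g := g))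
      (hne _ (mul_inverted_ne_one hs hs1 hx.odd))
    have h3 : g * x * g⁻¹ = (g * s * g⁻¹)⁻¹ * (g * (s * x) * g⁻¹) := by group
    rw [h3, h1, h2]
    have h4 : (s * a)⁻¹ * (s * b) = a⁻¹ * b := by group
    rw [h4]
    exact mul_mem (inv_mem ha) hb
  constructor
  rintro _ ⟨i, rfl⟩ g
  change g * x ^ i * g⁻¹ ∈ _
  rw [← conj_zpow]
  exact zpow_mem (hgx g) i

theorem smul_eq_of_commute (H : RealSemiregular L N) {s : L} (hs : s * s = 1) (hs1 : s ≠ 1)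
    {x : L} (hx : OddInverted s x)
    (hmax : ∀ w, OddInverted s w → Commute x w → w ∈ Subgroup.zpowers x) {d : L}
    (hd : Commute d x) {n : N} (hn : n ≠ 1) (hdn : d • n = n) : d = 1 := by
  have h1 : orderOf x ∣ Nat.card (fixedSubgroup N d) - 1 := by
    refine orderOf_dvd_card_sub_one ?_ fun a ha ha1 n hn =>
      H.free s a (hx.of_mem_zpowers ha ha1) n hn
    intro n hn
    change d • n = n at hn
    change d • x • n = x • n
    rw [← mul_smul, hd.eq, mul_smul, hn]
  rw [H.orderOf_eq hs hs1 hx hmax] at h1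
  obtain ⟨e, he⟩ := Subgroup.card_subgroup_dvd_card (fixedSubgroup N d)
  have h2 : 1 < Nat.card (fixedSubgroup N d) := by
    rw [Subgroup.one_lt_card_iff_ne_bot, Subgroup.ne_bot_iff_exists_ne_one]
    exact ⟨⟨n, hdn⟩, fun h => hn (congrArg Subtype.val h)⟩
  have h3 : e = 1 := eq_one_of_mul_eq_mul_self (H.one_lt_card_fixedSubgroup hs hs1) h2 h1
    (he.symm.trans (H.card_fixedSubgroup_mul_self hs hs1).symm)
  rw [h3, mul_one] at he
  have h4 : fixedSubgroup N d = ⊤ := (Subgroup.card_eq_iff_eq_top _).1 he.symm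
  apply H.faithful
  intro m
  have : m ∈ fixedSubgroup N d := h4 ▸ Subgroup.mem_top m
  exact this

theorem exists_normal_semiregular (H : RealSemiregular L N)
    (hO : ∀ K : Subgroup L, K.Normal → Odd K.index → K = ⊤) :
    ∃ D : Subgroup L, D.Normal ∧ (∃ k, D.index = 2 ^ k) ∧
      ∀ d ∈ D, ∀ n : N, n ≠ 1 → d • n = n → d = 1 := by
  have : Fact (Nat.Prime 2) := ⟨Nat.prime_two⟩
  let S : Sylow 2 L := default
  by_cases htriv : Subsingleton S
  · have h1 : (S : Subgroup L) = ⊥ := Subgroup.eq_bot_of_subsingleton _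
    have h2 : Odd ((⊥ : Subgroup L).index) := by
      rw [← h1]
      exact S.odd_index
    have h3 := hO ⊥ inferInstance h2
    refine ⟨⊥, inferInstance, ⟨0, ?_⟩, ?_⟩
    · rw [h3, Subgroup.index_top, pow_zero]
    · intro d hd _ _ _
      exact hd
  rw [not_subsingleton_iff_nontrivial] at htriv
  have hcen : Nontrivial (Subgroup.center S) := S.2.center_nontrivial
  have h2 : 2 ∣ Nat.card (Subgroup.center S) := by
    obtain ⟨m, hm⟩ := (S.2.to_subgroup (Subgroup.center S)).exists_card_eq
    have h3 : 1 < Nat.card (Subgroup.center S) := Finite.one_lt_card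
    rw [hm] at h3 ⊢
    refine dvd_pow_self 2 ?_
    rintro rfl
    simp at h3
  obtain ⟨⟨⟨s, hsS⟩, hsc⟩, hord⟩ := exists_prime_orderOf_dvd_card' 2 h2
  rw [Subgroup.orderOf_mk, Subgroup.orderOf_mk] at hord
  have hs : s * s = 1 := by rw [← pow_two, ← hord, pow_orderOf_eq_one]
  have hs1 : s ≠ 1 := by
    rintro rfl
    simp at hord
  have hsc' : ∀ a ∈ S, Commute a s := fun a ha =>
    congrArg Subtype.val (Subgroup.mem_center_iff.1 hsc ⟨a, ha⟩)
  obtain ⟨y, hy⟩ := H.exists_oddInverted hs hs1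
  obtain ⟨x, hx, -, hmax⟩ := H.exists_maximal hs1 hy
  have hnorm := H.zpowers_normal S hs hs1 hsc' hx hmax
  let D : Subgroup L := Subgroup.centralizer (Subgroup.zpowers x : Set L)
  have hDx : ∀ d, d ∈ D ↔ Commute d x := by
    intro d
    constructor
    · intro hd
      exact (hd x (Subgroup.mem_zpowers x)).symm
    · rintro hd _ ⟨i, rfl⟩
      exact (hd.symm.zpow_left i).eq
  have hDn : D.Normal := inferInstance
  have hcomm : ∀ a b : L, a * b * a⁻¹ * b⁻¹ ∈ D := by
    intro a b
    rw [hDx]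
    obtain ⟨i, hi⟩ := hnorm.conj_mem x (Subgroup.mem_zpowers x) a⁻¹
    obtain ⟨j, hj⟩ := hnorm.conj_mem x (Subgroup.mem_zpowers x) b⁻¹
    obtain ⟨k, hk⟩ := hnorm.conj_mem x (Subgroup.mem_zpowers x) (b⁻¹ * a⁻¹)
    change x ^ i = _ at hi
    change x ^ j = _ at hj
    have h3 : a⁻¹ * (b⁻¹ * x * b⁻¹⁻¹) * a⁻¹⁻¹ = b⁻¹ * (a⁻¹ * x * a⁻¹⁻¹) * b⁻¹⁻¹ := by
      rw [← hi, ← hj, ← conj_zpow, ← conj_zpow, ← hi, ← hj, ← zpow_mul, ← zpow_mul, mul_comm]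
    have h4 : a * b * a⁻¹ * b⁻¹ * x * (a * b * a⁻¹ * b⁻¹)⁻¹ =
        a * b * (a⁻¹ * (b⁻¹ * x * b⁻¹⁻¹) * a⁻¹⁻¹) * (a * b)⁻¹ := by group
    have h5 : a * b * a⁻¹ * b⁻¹ * x * (a * b * a⁻¹ * b⁻¹)⁻¹ = x := by
      rw [h4, h3]; group
    exact mul_inv_eq_iff_eq_mul.1 h5
  have hK : (S : Subgroup L) ⊔ D = ⊤ := by
    apply hO
    · constructor
      intro n hn g
      have h3 : g * n * g⁻¹ = g * n * g⁻¹ * n⁻¹ * n := by group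
      rw [h3]
      exact mul_mem (Subgroup.mem_sup_right (hcomm g n)) hn
    · exact Odd.of_dvd_nat S.odd_index (Subgroup.index_dvd_of_le le_sup_left)
  refine ⟨D, hDn, ?_, ?_⟩
  · have h3 : D.relIndex S = D.index := by
      rw [← Subgroup.relIndex_sup_right, hK, Subgroup.relIndex_top_right]
    obtain ⟨m, hm⟩ := S.2.exists_card_eq
    have h4 : D.relIndex S ∣ 2 ^ m := by
      rw [← hm]
      exact Subgroup.index_dvd_card _
    rw [h3] at h4
    obtain ⟨k, -, hk⟩ := (Nat.dvd_prime_pow Nat.prime_two).1 h4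
    exact ⟨k, hk⟩
  · intro d hd n hn hdn
    exact H.smul_eq_of_commute hs hs1 hx hmax ((hDx d).1 hd) hn hdn

end RealSemiregular

theorem iterate_mul_mul {G : Type*} [Group G] {α : Type*} (c : α → G) (φ : α → α) (a b : G)
    (h : ∀ x, c (φ x) = a * c x * b) (n : ℕ) (x : α) : c (φ^[n] x) = a ^ n * c x * b ^ n := by
  induction n generalizing x with
  | zero => simp
  | succ n ih =>
    rw [Function.iterate_succ_apply, ih, h, pow_succ, pow_succ']
    group

theorem exists_conj_eq_of_mul_mem {G : Type*} [Group G] [Finite G] {T : Subgroup G}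
    (hT : T.Normal) (hT2 : IsPGroup 2 T) {m : ℕ} (hm : Odd m) {x y : G} (hx : x ^ m = 1)
    (hy : y ^ m = 1) (hxy : x⁻¹ * y ∈ T) : ∃ τ ∈ T, τ * x * τ⁻¹ = y := by
  induction m using induction_on_primes generalizing x y with
  | zero => exact absurd hm (by decide)
  | one =>
    rw [pow_one] at hx hy
    exact ⟨1, one_mem _, by simp [hx, hy]⟩
  | prime_mul q m hq ih =>
    rw [Nat.odd_mul] at hm
    obtain ⟨hqo, hm⟩ := hm
    rw [pow_mul] at hx hy
    have h1 : (x ^ q)⁻¹ * y ^ q ∈ T := by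
      rw [← QuotientGroup.eq] at hxy ⊢
      rw [QuotientGroup.mk_pow, QuotientGroup.mk_pow, hxy]
    obtain ⟨τ, hτ, h2⟩ := ih hm hx hy h1
    have h3 : ∃ σ ∈ T, σ * (τ * x * τ⁻¹) * σ⁻¹ = y := by
      set w := τ * x * τ⁻¹ with hw
      have hwq : w ^ q = y ^ q := by rw [hw, conj_pow, h2]
      have hwy : y⁻¹ * w ∈ T := by
        have : y⁻¹ * w = ((x⁻¹ * y)⁻¹) * (x⁻¹ * τ * x) * τ⁻¹ := by rw [hw]; group
        rw [this]
        refine mul_mem (mul_mem (inv_mem hxy) ?_) (inv_mem hτ)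
        have := hT.conj_mem τ hτ x⁻¹
        rwa [inv_inv] at this
      let Z : Subgroup G := T ⊓ Subgroup.centralizer {y ^ q}
      have hZc : ∀ z ∈ Z, z * y ^ q = y ^ q * z := fun z hz =>
        Subgroup.mem_centralizer_singleton_iff.1 hz.2
      have hφ : ∀ z ∈ Z, y⁻¹ * z * w ∈ Z := by
        intro z hz
        refine ⟨?_, Subgroup.mem_centralizer_singleton_iff.2 ?_⟩
        · have : y⁻¹ * z * w = (y⁻¹ * z * y⁻¹⁻¹) * (y⁻¹ * w) := by group
          rw [this]
          exact mul_mem (hT.conj_mem z hz.1 _) hwy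
        · have c1 : Commute y⁻¹ (y ^ q) := ((Commute.refl y).pow_right q).inv_left
          have c2 : Commute z (y ^ q) := hZc z hz
          have c3 : Commute w (y ^ q) := by
            rw [← hwq]
            exact (Commute.refl w).pow_right q
          exact ((c1.mul_left c2).mul_left c3).eq
      let φ : Z → Z := fun z => ⟨y⁻¹ * z * w, hφ z z.2⟩
      have hcard : ¬ q ∣ Nat.card Z := by
        obtain ⟨k, hk⟩ := hT2.exists_card_eq
        intro h
        have h4 : q ∣ 2 ^ k := hk ▸ h.trans (Subgroup.card_dvd_of_le inf_le_left)
        have h5 := (Nat.prime_dvd_prime_iff_eq hq Nat.prime_two).1 (hq.dvd_of_dvd_pow h4)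
        rw [h5] at hqo
        exact absurd hqo (by decide)
      obtain ⟨z, hz⟩ := exists_fixed_of_not_dvd_card (f := φ) (k := 1) hq (by
        funext z
        apply Subtype.ext
        rw [pow_one, iterate_mul_mul (fun z : Z => (z : G)) φ y⁻¹ w (fun z => rfl), hwq, inv_pow,
          mul_assoc, hZc z z.2, inv_mul_cancel_left]
        rfl) hcard
      refine ⟨z, z.2.1, ?_⟩
      have h4 : y⁻¹ * (z : G) * w = z := congrArg Subtype.val hz
      rw [mul_assoc, inv_mul_eq_iff_eq_mul] at h4
      rw [h4, mul_inv_cancel_right]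
    obtain ⟨σ, hσ, h4⟩ := h3
    refine ⟨σ * τ, mul_mem hσ hτ, ?_⟩
    rw [← h4]
    group

theorem exists_pow_prime_power_order {G H : Type*} [Group G] [Finite G] [Group H] (f : G →* H)
    {y : G} (hy : f y ≠ 1) (hodd : Odd (orderOf (f y))) :
    ∃ i q a : ℕ, q.Prime ∧ q ≠ 2 ∧ (y ^ i) ^ q ^ a = 1 ∧ f (y ^ i) ≠ 1 := by
  induction hn : orderOf y using Nat.strong_induction_on generalizing y with
  | _ n ih =>
    have hy1 : orderOf y ≠ 1 := by
      rw [ne_eq, orderOf_eq_one_iff]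
      rintro rfl
      exact hy (map_one f)
    obtain ⟨q, hq, hqn⟩ := Nat.exists_prime_and_dvd hy1
    have hpos := orderOf_pos y
    by_cases h1 : f (y ^ q) = 1
    · rw [map_pow] at h1
      have : Fact q.Prime := ⟨hq⟩
      have h2 : orderOf (f y) = q := orderOf_eq_prime h1 hy
      obtain ⟨a, b, hb, hab⟩ := Nat.exists_eq_pow_mul_and_not_dvd hpos.ne' q hq.ne_one
      refine ⟨b, q, a, hq, ?_, ?_, ?_⟩
      · rintro rfl
        rw [h2] at hodd
        exact absurd hodd (by decide)
      · rw [← pow_mul, mul_comm, ← hab, pow_orderOf_eq_one]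
      · rw [map_pow]
        intro h3
        apply hb
        rw [← h2]
        exact orderOf_dvd_of_pow_eq_one h3
    · obtain ⟨i, q', a, h2, h3, h4, h5⟩ := ih (orderOf (y ^ q)) (by
        rw [orderOf_pow_of_dvd hq.ne_zero hqn, ← hn]
        exact Nat.div_lt_self hpos hq.one_lt) h1 (by
        rw [map_pow]
        exact odd_orderOf_pow hodd q) rfl
      rw [← pow_mul y] at h4 h5
      exact ⟨q * i, q', a, h2, h3, h4, h5⟩

theorem exists_mul_normalizes_sylow {G : Type*} [Group G] [Finite G] {p : ℕ} [Fact p.Prime]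
    {Y : Subgroup G} (P : Sylow p Y) {t : G} (ht : t ∈ Subgroup.normalizer (Y : Set G)) :
    ∃ y ∈ Y, ∀ x : Y, x ∈ P → ∃ x' : Y, x' ∈ P ∧ (x' : G) = (y * t) * x * (y * t)⁻¹ := by
  let α : MulAut Y := Y.normalizerMonoidHom ⟨t, ht⟩
  obtain ⟨y, hy⟩ := MulAction.exists_smul_eq Y (α • P) P
  refine ⟨y, y.2, fun x hx => ⟨MulAut.conj y • α • x, ?_, ?_⟩⟩
  · rw [← hy]
    change _ ∈ ((y • α • P : Sylow p Y) : Subgroup Y)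
    rw [Sylow.coe_subgroup_smul]
    exact Subgroup.smul_mem_pointwise_smul _ _ _ (Subgroup.smul_mem_pointwise_smul _ _ _ hx)
  · change (y : G) * (t * x * t⁻¹) * (y : G)⁻¹ = _
    group

theorem conj_pow_eq_inv_of_odd {G : Type*} [Group G] {t z : G} (h : t * z * t⁻¹ = z⁻¹) {m : ℕ}
    (hm : Odd m) : t ^ m * z * (t ^ m)⁻¹ = z⁻¹ := by
  obtain ⟨j, rfl⟩ := hm
  have h1 : Commute (t * t) z := commute_of_inverted_of_inverted h h
  have h2 : t ^ (2 * j + 1) = t * (t * t) ^ j := by rw [pow_succ', pow_mul, pow_two]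
  have h3 : (t * t) ^ j * z * ((t * t) ^ j)⁻¹ = z := mul_inv_eq_iff_eq_mul.2 (h1.pow_left j).eq
  rw [h2, mul_inv_rev]
  have h4 : t * (t * t) ^ j * z * (((t * t) ^ j)⁻¹ * t⁻¹) =
      t * ((t * t) ^ j * z * ((t * t) ^ j)⁻¹) * t⁻¹ := by group
  rw [h4, h3, h]

theorem exists_odd_pow_two_element {G : Type*} [Group G] [Finite G] (t : G) :
    ∃ m k : ℕ, Odd m ∧ (t ^ m) ^ 2 ^ k = 1 := by
  obtain ⟨k, m, hm, h⟩ := Nat.exists_eq_two_pow_mul_odd (orderOf_pos t).ne'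
  exact ⟨m, k, hm, by rw [← pow_mul, mul_comm, ← h, pow_orderOf_eq_one]⟩

theorem exists_real_lift {G H : Type*} [Group G] [Finite G] [Group H] [Finite H] (f : G →* H)
    {t y : G} (hy : f y ≠ 1) (hodd : Odd (orderOf (f y)))
    (hinv : f t * f y * (f t)⁻¹ = (f y)⁻¹) :
    ∃ u v : G, f v ∈ Subgroup.zpowers (f y) ∧ f v ≠ 1 ∧ Odd (orderOf v) ∧
      u * v * u⁻¹ = v⁻¹ := by
  obtain ⟨i, q, a, hq, hq2, hza, hz1⟩ := exists_pow_prime_power_order f hy hodd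
  have : Fact q.Prime := ⟨hq⟩
  have hzy : f (y ^ i) ∈ Subgroup.zpowers (f y) := by
    rw [map_pow]
    exact Subgroup.npow_mem_zpowers _ _
  have hzinv : f t * f (y ^ i) * (f t)⁻¹ = (f (y ^ i))⁻¹ := by
    rw [map_pow, ← conj_pow, hinv, inv_pow]
  generalize y ^ i = z at hza hz1 hzy hzinv
  let Y : Subgroup G := (Subgroup.zpowers (f z)).comap f
  have htY : t ∈ Subgroup.normalizer (Y : Set G) := by
    apply Subgroup.mem_normalizer_fintype
    intro n hn
    change f (t * n * t⁻¹) ∈ Subgroup.zpowers (f z)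
    rw [map_mul, map_mul, map_inv, conj_eq_inv_of_mem_zpowers hzinv hn]
    exact inv_mem hn
  have hzY : z ∈ Y := Subgroup.mem_zpowers (f z)
  have hqz : IsPGroup q (Subgroup.zpowers (⟨z, hzY⟩ : Y)) := by
    rintro ⟨_, j, rfl⟩
    refine ⟨a, Subtype.ext (Subtype.ext ?_)⟩
    change (z ^ j) ^ q ^ a = 1
    rw [← zpow_natCast, ← zpow_mul, mul_comm, zpow_mul, zpow_natCast, hza, one_zpow]
  obtain ⟨P, hP⟩ := hqz.exists_le_sylow
  obtain ⟨y₀, hy₀, hconj⟩ := exists_mul_normalizes_sylow P htY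
  let P' : Subgroup G := (P : Subgroup Y).map Y.subtype
  have hP' : ∀ x ∈ P', (y₀ * t) * x * (y₀ * t)⁻¹ ∈ P' := by
    rintro _ ⟨x, hx, rfl⟩
    obtain ⟨x', hx', h⟩ := hconj x hx
    exact ⟨x', hx', h⟩
  have hinv₀ : f (y₀ * t) * f z * (f (y₀ * t))⁻¹ = (f z)⁻¹ := by
    have hc : Commute (f y₀) (f z) := by
      obtain ⟨j, hj⟩ := hy₀
      change f z ^ j = f y₀ at hj
      rw [← hj]
      exact (Commute.refl _).zpow_left j
    have h1 : f (y₀ * t) * f z * (f (y₀ * t))⁻¹ = f y₀ * (f t * f z * (f t)⁻¹) * (f y₀)⁻¹ := by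
      rw [map_mul]; group
    rw [h1, hzinv]
    exact mul_inv_eq_iff_eq_mul.2 hc.inv_right.eq
  obtain ⟨m, k, hm, hmk⟩ := exists_odd_pow_two_element (y₀ * t)
  have hPm : ∀ n : ℕ, ∀ x ∈ P', (y₀ * t) ^ n * x * ((y₀ * t) ^ n)⁻¹ ∈ P' := by
    intro n
    induction n with
    | zero => intro x hx; simpa using hx
    | succ n ih =>
      intro x hx
      have h1 : (y₀ * t) ^ (n + 1) * x * ((y₀ * t) ^ (n + 1))⁻¹ =
          (y₀ * t) * ((y₀ * t) ^ n * x * ((y₀ * t) ^ n)⁻¹) * (y₀ * t)⁻¹ := by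
        rw [pow_succ', mul_inv_rev]
        simp only [mul_assoc]
      rw [h1]
      exact hP' _ (ih x hx)
  have hPm := hPm m
  have hinvm := conj_pow_eq_inv_of_odd hinv₀ hm
  rw [← map_pow] at hinvm
  generalize (y₀ * t) ^ m = t₁ at hmk hPm hinvm
  have hzP : z ∈ P' := ⟨⟨z, hzY⟩, hP (Subgroup.mem_zpowers _), rfl⟩
  have hPq : IsPGroup q P' := P.2.map _
  let σ : {x : G // x ∈ P' ∧ f x = f z} → {x : G // x ∈ P' ∧ f x = f z} := fun x =>
    ⟨t₁ * (x : G)⁻¹ * t₁⁻¹, hPm _ (P'.inv_mem x.2.1), by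
      rw [map_mul, map_mul, map_inv, map_inv, x.2.2, ← conj_inv, hinvm, inv_inv]⟩
  have hcard : Odd (Nat.card {x : G // x ∈ P' ∧ f x = f z}) := by
    have h1 : Nat.card {x : G // x ∈ P' ∧ f x = f z} = Nat.card (P' ⊓ f.ker : Subgroup G) := by
      refine Nat.card_congr ⟨fun x => ⟨x * z⁻¹, P'.mul_mem x.2.1 (P'.inv_mem hzP), ?_⟩,
        fun x => ⟨x * z, mul_mem x.2.1 hzP, ?_⟩, fun x => Subtype.ext ?_, fun x => Subtype.ext ?_⟩
      · change f (x * z⁻¹) = 1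
        rw [map_mul, map_inv, x.2.2, mul_inv_cancel]
      · have h2 : f x = 1 := x.2.2
        rw [map_mul, h2, one_mul]
      · exact inv_mul_cancel_right (x : G) z
      · exact mul_inv_cancel_right (x : G) z
    rw [h1]
    obtain ⟨b, hb⟩ := hPq.exists_card_eq
    refine Odd.of_dvd_nat ?_ (Subgroup.card_dvd_of_le (inf_le_left : P' ⊓ f.ker ≤ P'))
    rw [hb]
    exact (hq.odd_of_ne_two hq2).pow
  have hσ : ∀ x, ((σ^[2] x : {x : G // x ∈ P' ∧ f x = f z}) : G) = t₁ ^ 2 * (x : G) * (t₁ ^ 2)⁻¹ := by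
    intro x
    change t₁ * (t₁ * (x : G)⁻¹ * t₁⁻¹)⁻¹ * t₁⁻¹ = _
    rw [pow_two]
    group
  obtain ⟨x, hx⟩ := exists_fixed_of_odd_card (f := σ) (k := k + 1) (by
    funext x
    apply Subtype.ext
    rw [pow_succ', Function.iterate_mul, iterate_mul_mul
      (fun x : {x : G // x ∈ P' ∧ f x = f z} => (x : G)) _ _ _ hσ, inv_pow, ← pow_mul, mul_comm 2,
      pow_mul, hmk]
    simp) hcard
  have hx' : t₁ * (x : G)⁻¹ * t₁⁻¹ = x := congrArg Subtype.val hx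
  refine ⟨t₁, x, ?_, ?_, ?_, ?_⟩
  · rw [x.2.2]; exact hzy
  · rw [x.2.2]; exact hz1
  · obtain ⟨b, hb⟩ := hPq ⟨x, x.2.1⟩
    have hb' : (x : G) ^ q ^ b = 1 := congrArg Subtype.val hb
    exact Odd.of_dvd_nat (hq.odd_of_ne_two hq2).pow (orderOf_dvd_of_pow_eq_one hb')
  · rw [← inv_inj, conj_inv, hx', inv_inv]

theorem isPGroup_normalClosure_singleton {H : Type*} [Group H] [Finite H] {t : H} (ht : t * t = 1)
    {M : Subgroup H} (hM : M.Normal) (htM : t ∈ M)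
    (h : ∀ s y : H, y ∈ M → Odd (orderOf y) → s * y * s⁻¹ = y⁻¹ → y = 1) :
    IsPGroup 2 (Subgroup.normalClosure {t}) := by
  have : Fact (Nat.Prime 2) := ⟨Nat.prime_two⟩
  have h1 : ∀ g : H, ∃ k, (t * (g * t * g⁻¹)) ^ 2 ^ k = 1 := by
    intro g
    obtain ⟨k, hk⟩ := exists_pow_two_pow_odd_orderOf (t * (g * t * g⁻¹))
    refine ⟨k, h t _ ?_ hk ?_⟩
    · exact pow_mem (mul_mem htM (hM.conj_mem t htM g)) _
    · rw [← conj_pow, conj_involution_mul ht (conj_conj_self ht), inv_pow]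
  let S : Sylow 2 H := default
  have h2 : Subgroup.normalClosure {t} ≤ (S : Subgroup H) := by
    rw [Subgroup.normalClosure, Subgroup.closure_le]
    intro y hy
    obtain ⟨a, ha, hay⟩ := Group.mem_conjugatesOfSet_iff.1 hy
    rw [Set.mem_singleton_iff] at ha
    subst ha
    obtain ⟨g, rfl⟩ := isConj_iff.1 hay
    refine mem_sylow_of_forall_conj (conj_conj_self ht) ?_ S
    intro x
    obtain ⟨k, hk⟩ := h1 (g⁻¹ * x * g)
    refine ⟨k, ?_⟩
    have h3 : g * a * g⁻¹ * (x * (g * a * g⁻¹) * x⁻¹) =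
        g * (a * (g⁻¹ * x * g * a * (g⁻¹ * x * g)⁻¹)) * g⁻¹ := by group
    rw [h3, conj_pow, hk]
    group
  exact S.2.to_le h2

theorem exists_normal_two_power_odd {G : Type*} [Group G] [Finite G]
    (hO : ∀ N : Subgroup G, N.Normal → Odd N.index → N = ⊤) {C K : Subgroup G} (hC : C.Normal)
    (hK : K.Normal) (hCK : C ≤ K)
    (h : ∀ u y : G, u * y * u⁻¹ = y⁻¹ → Odd (orderOf y) → y ∈ K → y ∈ C) :
    ∃ T : Subgroup G, T.Normal ∧ C ≤ T ∧ T ≤ K ∧ (∃ k, C.relIndex T = 2 ^ k) ∧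
      Odd (T.relIndex K) ∧ ∀ g : G, ∀ k ∈ K, g * k * g⁻¹ * k⁻¹ ∈ T := by
  have : Fact (Nat.Prime 2) := ⟨Nat.prime_two⟩
  obtain ⟨T, ⟨hT, hCT, hTK, hk⟩, hmax⟩ := Set.Finite.exists_maximal
    (s := {T : Subgroup G | T.Normal ∧ C ≤ T ∧ T ≤ K ∧ ∃ k, C.relIndex T = 2 ^ k}) (Set.toFinite _)
    ⟨C, hC, le_rfl, hCK, 0, by rw [Subgroup.relIndex_self, pow_zero]⟩
  let f := QuotientGroup.mk' T
  have hfT : ∀ g, f g = 1 ↔ g ∈ T := fun g => QuotientGroup.eq_one_iff g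
  have hfs : Function.Surjective f := QuotientGroup.mk'_surjective T
  let M := K.map f
  have hM : M.Normal := hK.map f hfs
  have hfM : ∀ g, f g ∈ M ↔ g ∈ K := by
    intro g
    constructor
    · rintro ⟨k, hk, hkg⟩
      have h1 : k⁻¹ * g ∈ T := by
        rw [← hfT, map_mul, map_inv, hkg, inv_mul_cancel]
      have h2 := mul_mem hk (hTK h1)
      rwa [mul_inv_cancel_left] at h2
    · exact fun hg => Subgroup.mem_map_of_mem f hg
  have hstar : ∀ s y : G ⧸ T, y ∈ M → Odd (orderOf y) → s * y * s⁻¹ = y⁻¹ → y = 1 := by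
    intro s y hyM hodd hinv
    obtain ⟨t, rfl⟩ := hfs s
    obtain ⟨y, rfl⟩ := hfs y
    by_contra hy1
    obtain ⟨u, v, h1, h2, h3, h4⟩ := exists_real_lift f hy1 hodd hinv
    have h5 : v ∈ K := (hfM v).1 ((Subgroup.zpowers_le.2 hyM) h1)
    exact h2 ((hfT v).2 (hCT (h u v h4 h3 h5)))
  have hcardM : Nat.card M = T.relIndex K := by
    have h1 := Subgroup.relIndex_ker K f
    rw [QuotientGroup.ker_mk'] at h1
    exact h1.symm
  have hodd : Odd (T.relIndex K) := by
    by_contra he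
    rw [Nat.not_odd_iff_even, even_iff_two_dvd, ← hcardM] at he
    obtain ⟨⟨t, htM⟩, hord⟩ := exists_prime_orderOf_dvd_card' 2 he
    rw [Subgroup.orderOf_mk] at hord
    have ht : t * t = 1 := by rw [← pow_two, ← hord, pow_orderOf_eq_one]
    have hE := isPGroup_normalClosure_singleton ht hM htM hstar
    have hEM : Subgroup.normalClosure {t} ≤ M :=
      Subgroup.normalClosure_le_normal (by simpa using htM)
    have hT' : (Subgroup.normalClosure {t}).comap f ∈
        {T : Subgroup G | T.Normal ∧ C ≤ T ∧ T ≤ K ∧ ∃ k, C.relIndex T = 2 ^ k} := by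
      have hTT' : T ≤ (Subgroup.normalClosure {t}).comap f := by
        intro g hg
        rw [Subgroup.mem_comap, (hfT g).2 hg]
        exact one_mem _
      refine ⟨inferInstance, hCT.trans hTT', ?_, ?_⟩
      · intro g hg
        exact (hfM g).1 (hEM hg)
      · obtain ⟨k, hk⟩ := hk
        have h1 := Subgroup.relIndex_ker ((Subgroup.normalClosure {t}).comap f) f
        rw [QuotientGroup.ker_mk', Subgroup.map_comap_eq_self_of_surjective hfs] at h1
        obtain ⟨m, hm⟩ := hE.exists_card_eq
        refine ⟨k + m, ?_⟩
        rw [← Subgroup.relIndex_mul_relIndex _ _ _ hCT hTT', hk, h1, hm, pow_add]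
    have hle := hmax hT' (fun g hg => by
      rw [Subgroup.mem_comap, (hfT g).2 hg]
      exact one_mem _)
    obtain ⟨g, rfl⟩ := hfs t
    have h1 : g ∈ T := hle (Subgroup.subset_normalClosure (by simp))
    rw [(hfT g).2 h1, orderOf_one] at hord
    exact absurd hord (by decide)
  refine ⟨T, hT, hCT, hTK, hk, hodd, ?_⟩
  let Z : Subgroup G := (Subgroup.centralizer (M : Set (G ⧸ T))).comap f
  have hZ : ∀ g, g ∈ Z ↔ ∀ k ∈ M, k * f g = f g * k := fun g => Iff.rfl
  have htwo : ∀ n : ℕ, ∀ σ : G, σ ^ 2 ^ n = 1 → σ ∈ Z := by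
    intro n
    induction n with
    | zero =>
      intro σ hσ
      rw [pow_zero, pow_one] at hσ
      rw [hσ]
      exact one_mem _
    | succ n ih =>
      intro σ hσ
      rw [pow_succ', pow_mul] at hσ
      have h1 := (hZ _).1 (ih _ hσ)
      rw [hZ]
      intro κ hκ
      have h2 := h1 κ hκ
      have h3 : κ⁻¹ * (f σ * κ * (f σ)⁻¹) = 1 := by
        have hmem : κ⁻¹ * (f σ * κ * (f σ)⁻¹) ∈ M := mul_mem (inv_mem hκ) (hM.conj_mem κ hκ _)
        refine hstar (f σ) _ hmem ?_ ?_
        · refine Odd.of_dvd_nat hodd ?_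
          rw [← hcardM]
          exact Subgroup.orderOf_dvd_natCard _ hmem
        · have h4 : f σ * (κ⁻¹ * (f σ * κ * (f σ)⁻¹)) * (f σ)⁻¹ =
              f σ * κ⁻¹ * (f σ)⁻¹ * ((f σ ^ 2) * κ * (f σ ^ 2)⁻¹) := by
            rw [pow_two]; group
          rw [map_pow] at h2
          rw [h4, ← h2]
          group
      have h5 : κ = f σ * κ * (f σ)⁻¹ := inv_mul_eq_one.1 h3
      exact eq_mul_inv_iff_mul_eq.1 h5
  have hZtop : Z = ⊤ := by
    apply hO
    · exact inferInstance
    · let S : Sylow 2 G := default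
      refine Odd.of_dvd_nat S.odd_index (Subgroup.index_dvd_of_le ?_)
      intro σ hσ
      obtain ⟨n, hn⟩ := S.2 ⟨σ, hσ⟩
      exact htwo n σ (congrArg Subtype.val hn)
  intro g k hk
  have h1 : g ∈ Z := hZtop ▸ Subgroup.mem_top g
  have h2 := (hZ g).1 h1 (f k) (Subgroup.mem_map_of_mem f hk)
  rw [← hfT, map_mul, map_mul, map_mul, map_inv, map_inv, ← h2]
  group

theorem mem_of_pow_mem_of_coprime {G : Type*} [Group G] {D : Subgroup G} {g : G} {m n : ℕ}
    (hmn : m.Coprime n) (hm : g ^ m ∈ D) (hn : g ^ n ∈ D) : g ∈ D := by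
  have h := Nat.gcd_eq_gcd_ab m n
  rw [hmn.gcd_eq_one, Nat.cast_one] at h
  rw [← zpow_one g, h, zpow_add, zpow_mul, zpow_mul, zpow_natCast, zpow_natCast]
  exact mul_mem (zpow_mem hm _) (zpow_mem hn _)

theorem exists_pow_odd_orderOf_map_eq {G L : Type*} [Group G] [Finite G] [Group L] (f : G →* L)
    {a : G} (ha : Odd (orderOf (f a))) : ∃ c : ℕ, Odd (orderOf (a ^ c)) ∧ f (a ^ c) = f a := by
  obtain ⟨k, m, hm, h⟩ := Nat.exists_eq_two_pow_mul_odd (orderOf_pos a).ne'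
  have hcop : Nat.Coprime (2 ^ k) (orderOf (f a)) :=
    Nat.Coprime.pow_left k (Nat.coprime_two_left.2 ha)
  obtain ⟨c, hc1, hc2⟩ := Nat.chineseRemainder hcop 0 1
  refine ⟨c, ?_, ?_⟩
  · refine Odd.of_dvd_nat hm (orderOf_dvd_of_pow_eq_one ?_)
    rw [← pow_mul]
    obtain ⟨d, rfl⟩ := (Nat.modEq_zero_iff_dvd).1 hc1
    rw [mul_right_comm, ← h, pow_mul, pow_orderOf_eq_one, one_pow]
  · rw [map_pow]
    conv_rhs => rw [← pow_one (f a)]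
    exact pow_eq_pow_iff_modEq.2 hc2

theorem eq_bot_of_central_sylow {M : Type*} [Group M] [Finite M]
    (hO : ∀ N : Subgroup M, N.Normal → Odd N.index → N = ⊤) {q : ℕ} [hq : Fact q.Prime]
    (hq2 : q ≠ 2) (P : Sylow q M) (hP : ∀ p ∈ P, ∀ g : M, p * g = g * p) :
    (P : Subgroup M) = ⊥ := by
  have hPc : Subgroup.normalizer ((P : Subgroup M) : Set M) ≤ Subgroup.centralizer (P : Set M) :=
    fun g _ p hp => hP p hp g
  have h1 := MonoidHom.ker_transferSylow_isComplement' P hPc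
  have h2 : Odd (MonoidHom.transferSylow P hPc).ker.index := by
    rw [h1.symm.index_eq_card]
    obtain ⟨n, hn⟩ := P.2.exists_card_eq
    rw [hn]
    exact (hq.out.odd_of_ne_two hq2).pow
  have h3 := hO _ inferInstance h2
  rw [h3] at h1
  exact Subgroup.isComplement'_top_left.1 h1

theorem eq_top_of_surjective {G M : Type*} [Group G] [Group M] {f : G →* M}
    (hf : Function.Surjective f) (hO : ∀ N : Subgroup G, N.Normal → Odd N.index → N = ⊤)
    (N : Subgroup M) (hN : N.Normal) (ho : Odd N.index) : N = ⊤ := by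
  apply Subgroup.comap_injective hf
  rw [Subgroup.comap_top]
  apply hO _ (hN.comap f)
  rwa [Subgroup.index_comap_of_surjective _ hf]

/-- An inverted odd order element modulo a normal extension of a central odd quotient by a
`2`-group lifts to an inverted odd order element. -/
theorem exists_inverted_lift {G L : Type*} [Group G] [Finite G] [Group L] {r : G →* L}
    {T : Subgroup G} (hT : T.Normal) (hT2 : IsPGroup 2 T)
    (hodd : Odd (T.relIndex r.ker)) (hcen : ∀ g : G, ∀ k ∈ r.ker, g * k * g⁻¹ * k⁻¹ ∈ T) {a b : G}
    (ha : Odd (orderOf (r a))) (hab : r b * r a * (r b)⁻¹ = (r a)⁻¹) :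
    ∃ u v : G, u * v * u⁻¹ = v⁻¹ ∧ Odd (orderOf v) ∧ r v = r a := by
  let f := QuotientGroup.mk' T
  have hfT : ∀ g, f g = 1 ↔ g ∈ T := fun g => QuotientGroup.eq_one_iff g
  have hfc : ∀ g : G, ∀ k ∈ r.ker, f g * f k = f k * f g := by
    intro g k hk
    have h1 := (hfT _).2 (hcen g k hk)
    rw [map_mul, map_mul, map_mul, map_inv, map_inv, mul_inv_eq_one, mul_inv_eq_iff_eq_mul] at h1
    exact h1
  set k := a * (b * a * b⁻¹) with hk
  have hkK : k ∈ r.ker := by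
    rw [MonoidHom.mem_ker, hk, map_mul, map_mul, map_mul, map_inv, hab, mul_inv_cancel]
  obtain ⟨j, hj⟩ := hodd
  have hkT : f k ^ (2 * j + 1) = 1 := by
    rw [← map_pow, hfT, ← hj]
    have h1 := Subgroup.pow_index_mem (T.subgroupOf r.ker) ⟨k, hkK⟩
    exact h1
  have hκ : k ^ j ∈ r.ker := pow_mem hkK j
  have h1 : f b * f (a * k ^ j) * (f b)⁻¹ = (f (a * k ^ j))⁻¹ := by
    have h2 : f (a * k ^ j) = f a * f (k ^ j) := map_mul _ _ _
    have h3 : f b * f a * (f b)⁻¹ = (f a)⁻¹ * f k := by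
      rw [hk, map_mul, map_mul, map_mul, map_inv]; group
    have h4 : f b * f (k ^ j) * (f b)⁻¹ = f (k ^ j) := mul_inv_eq_iff_eq_mul.2 (hfc b _ hκ)
    have h5 : f b * (f a * f (k ^ j)) * (f b)⁻¹ =
        (f b * f a * (f b)⁻¹) * (f b * f (k ^ j) * (f b)⁻¹) := by group
    have h6 : f k * f (k ^ j) = (f (k ^ j))⁻¹ := by
      rw [eq_inv_iff_mul_eq_one, map_pow, ← hkT, ← pow_succ', ← pow_add]
      congr 1
      omega
    rw [h2, h5, h3, h4, mul_assoc, h6, hfc a _ hκ, mul_inv_rev]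
  have hra : r (a * k ^ j) = r a := by
    rw [map_mul, MonoidHom.mem_ker.1 hκ, mul_one]
  obtain ⟨c, hc, hrc⟩ := exists_pow_odd_orderOf_map_eq r (a := a * k ^ j) (by rwa [hra])
  have h2 : f b * f ((a * k ^ j) ^ c) * (f b)⁻¹ = (f ((a * k ^ j) ^ c))⁻¹ := by
    rw [map_pow, ← conj_pow, h1, inv_pow]
  rw [hra] at hrc
  generalize (a * k ^ j) ^ c = v at hc hrc h2
  obtain ⟨τ, -, h3⟩ := exists_conj_eq_of_mul_mem hT hT2 hc (x := b * v * b⁻¹) (y := v⁻¹)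
    (by rw [conj_pow, pow_orderOf_eq_one]; group) (by rw [inv_pow, pow_orderOf_eq_one, inv_one])
    (by rw [← hfT, map_mul, map_inv, map_inv, map_mul, map_mul, map_inv, h2, inv_mul_cancel])
  refine ⟨τ * b, v, ?_, hc, hrc⟩
  rw [← h3]
  group

section ElementaryNormal

variable {G : Type*} [Group G] {N : Subgroup G}

theorem conjNormal_smul_eq_iff [N.Normal] {g h : G} {n : N} :
    (MulAut.conjNormal (H := N)).rangeRestrict g • n =
      (MulAut.conjNormal (H := N)).rangeRestrict h • n ↔
      g * (n : G) * g⁻¹ = h * (n : G) * h⁻¹ := by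
  rw [← Subtype.coe_inj]
  exact Iff.rfl

theorem conjNormal_smul_eq_self_iff [N.Normal] {g : G} {n : N} :
    (MulAut.conjNormal (H := N)).rangeRestrict g • n = n ↔ Commute g (n : G) := by
  rw [← Subtype.coe_inj]
  exact mul_inv_eq_iff_eq_mul

theorem mem_ker_conjNormal [N.Normal] {g : G} :
    g ∈ (MulAut.conjNormal (H := N)).ker ↔ ∀ n ∈ N, Commute g n := by
  rw [MonoidHom.mem_ker]
  constructor
  · intro h n hn
    have h1 : MulAut.conjNormal g (⟨n, hn⟩ : N) = ⟨n, hn⟩ := by rw [h]; rfl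
    exact mul_inv_eq_iff_eq_mul.1 (congrArg Subtype.val h1)
  · intro h
    ext n
    exact mul_inv_eq_iff_eq_mul.2 (h n n.2)

theorem dvd_index_centralizer_of_elementary [Finite G]
    (hO : ∀ N : Subgroup G, N.Normal → Odd N.index → N = ⊤) [N.Normal]
    (hN2 : ∀ n ∈ N, n * n = 1)
    (hodd : ∀ n ∈ N, Odd (Subgroup.centralizer {n}).index)
    (htrans : ∀ u z : G, u * z * u⁻¹ = z⁻¹ → Odd (orderOf z) → z ≠ 1 → ∀ n ∈ N, ∀ g : G,
      ∃ d : G, Commute d z ∧ d * n * d⁻¹ = g * n * g⁻¹)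
    (hfree : ∀ u z : G, u * z * u⁻¹ = z⁻¹ → Odd (orderOf z) → z ≠ 1 → ∀ n ∈ N, Commute z n →
      n = 1) {n : G} (hn : n ∈ N) (hn1 : n ≠ 1) {q : ℕ} (hq : q.Prime) (hq2 : q ≠ 2)
    (hqG : q ∣ Nat.card G) : q ∣ (Subgroup.centralizer {n}).index := by
  let r := (MulAut.conjNormal (H := N)).rangeRestrict
  have hrs : Function.Surjective r := MonoidHom.rangeRestrict_surjective _
  have hrker : r.ker = (MulAut.conjNormal (H := N)).ker := MonoidHom.ker_rangeRestrict _
  obtain ⟨T, hT, -, -, hTcard, hTodd, hTcen⟩ := exists_normal_two_power_odd hO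
    (C := ⊥) (K := r.ker) inferInstance inferInstance bot_le (by
      intro u y huy hy hyK
      rw [hrker, mem_ker_conjNormal] at hyK
      by_contra hy1
      exact hn1 (hfree u y huy hy hy1 n hn (hyK n hn)))
  have hT2 : IsPGroup 2 T := by
    obtain ⟨k, hk⟩ := hTcard
    rw [Subgroup.relIndex_bot_left] at hk
    exact IsPGroup.of_card hk
  have hlift : ∀ t y, OddInverted t y →
      ∃ u v : G, u * v * u⁻¹ = v⁻¹ ∧ Odd (orderOf v) ∧ v ≠ 1 ∧ r v = y := by
    intro t y hty
    obtain ⟨b, rfl⟩ := hrs t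
    obtain ⟨a, rfl⟩ := hrs y
    obtain ⟨u, v, h1, h2, h3⟩ := exists_inverted_lift hT hT2 hTodd hTcen hty.odd hty.conj
    refine ⟨u, v, h1, h2, ?_, h3⟩
    rintro rfl
    exact hty.ne_one (by rw [← h3, map_one])
  have H : RealSemiregular (MulAut.conjNormal (H := N)).range N := by
    refine ⟨fun n => Subtype.ext (hN2 n n.2), ?_, ?_, ?_, ?_⟩
    · intro a ha
      exact Subtype.ext (MulEquiv.ext ha)
    · intro n
      have h1 : (MulAction.stabilizer (MulAut.conjNormal (H := N)).range n).comap r =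
          Subgroup.centralizer {(n : G)} := by
        ext g
        rw [Subgroup.mem_centralizer_singleton_iff]
        exact conjNormal_smul_eq_self_iff
      rw [← Subgroup.index_comap_of_surjective _ hrs, h1]
      exact hodd n n.2
    · intro t y hty n hyn
      obtain ⟨u, v, h1, h2, h3, rfl⟩ := hlift t y hty
      exact Subtype.ext (hfree u v h1 h2 h3 n n.2 (conjNormal_smul_eq_self_iff.1 hyn))
    · intro t y hty n g
      obtain ⟨u, v, h1, h2, h3, rfl⟩ := hlift t y hty
      obtain ⟨g, rfl⟩ := hrs g
      obtain ⟨d, hd, hdg⟩ := htrans u v h1 h2 h3 n n.2 g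
      exact ⟨r d, hd.map r, conjNormal_smul_eq_iff.2 hdg⟩
  obtain ⟨D, hD, ⟨k, hDk⟩, hDfree⟩ := H.exists_normal_semiregular (eq_top_of_surjective hrs hO)
  have : Fact q.Prime := ⟨hq⟩
  by_contra hnd
  obtain ⟨P, hP⟩ := exists_sylow_le_of_not_dvd_index hnd
  have hPK : (P : Subgroup G) ≤ r.ker := by
    intro p hp
    obtain ⟨a, ha⟩ := P.2 ⟨p, hp⟩
    have ha' : p ^ q ^ a = 1 := congrArg Subtype.val ha
    have hpD : r p ∈ D := by
      refine mem_of_pow_mem_of_coprime (m := 2 ^ k) (n := q ^ a) ?_ ?_ ?_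
      · exact Nat.Coprime.pow k a ((Nat.coprime_primes Nat.prime_two hq).2 (Ne.symm hq2))
      · rw [← hDk]
        exact Subgroup.pow_index_mem D _
      · rw [← map_pow, ha', map_one]
        exact one_mem _
    refine hDfree (r p) hpD ⟨n, hn⟩ (fun h => hn1 (congrArg Subtype.val h)) ?_
    exact conjNormal_smul_eq_self_iff.2 (Subgroup.mem_centralizer_singleton_iff.1 (hP hp))
  let f := QuotientGroup.mk' T
  have hfs : Function.Surjective f := QuotientGroup.mk'_surjective T
  have h1 := eq_bot_of_central_sylow (eq_top_of_surjective hfs hO) hq2 (P.mapSurjective hfs) (by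
    rintro _ ⟨p, hp, rfl⟩ g
    obtain ⟨g, rfl⟩ := hfs g
    have h2 : f (g * p * g⁻¹ * p⁻¹) = 1 := (QuotientGroup.eq_one_iff _).2 (hTcen g p (hPK hp))
    rw [map_mul, map_mul, map_mul, map_inv, map_inv, mul_inv_eq_one, mul_inv_eq_iff_eq_mul] at h2
    exact h2.symm)
  have h2 : (P : Subgroup G) ≤ T := by
    intro p hp
    have h3 : f p ∈ ((P.mapSurjective hfs : Sylow q (G ⧸ T)) : Subgroup (G ⧸ T)) :=
      Subgroup.mem_map_of_mem f hp
    rw [h1] at h3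
    exact (QuotientGroup.eq_one_iff p).1 h3
  have h3 := P.dvd_card_of_dvd_card hqG
  obtain ⟨m, hm⟩ := hT2.exists_card_eq
  have h4 : q ∣ 2 ^ m := hm ▸ h3.trans (Subgroup.card_dvd_of_le h2)
  exact hq2 ((Nat.prime_dvd_prime_iff_eq hq Nat.prime_two).1 (hq.dvd_of_dvd_pow h4))

end ElementaryNormal

section RealClasses

variable {G : Type*} [Group G]

theorem ncard_conjugatesOf (x : G) :
    (conjugatesOf x).ncard = (Subgroup.centralizer {x}).index := by
  have h1 : MulAction.orbit (ConjAct G) x = conjugatesOf x := by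
    ext y
    rw [ConjAct.mem_orbit_conjAct, isConj_comm]
    rfl
  have h2 : MulAction.stabilizer (ConjAct G) x =
      (Subgroup.centralizer {x}).comap (ConjAct.ofConjAct (G := G)).toMonoidHom := by
    ext g
    rw [MulAction.mem_stabilizer_iff, Subgroup.mem_comap, Subgroup.mem_centralizer_singleton_iff,
      ConjAct.smul_def, mul_inv_eq_iff_eq_mul]
    rfl
  rw [← h1, ← MulAction.index_stabilizer, h2,
    Subgroup.index_comap_of_surjective _ (ConjAct.ofConjAct (G := G)).surjective]

theorem index_centralizer_inf_of_coprime [Finite G] {x i : G}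
    (h : ((Subgroup.centralizer {x}).index).Coprime (Subgroup.centralizer {i}).index) :
    (Subgroup.centralizer {x} ⊓ Subgroup.centralizer {i}).index =
      (Subgroup.centralizer {x}).index * (Subgroup.centralizer {i}).index := by
  refine le_antisymm Subgroup.index_inf_le (Nat.le_of_dvd ?_ ?_)
  · exact Nat.pos_of_ne_zero Subgroup.index_ne_zero_of_finite
  · exact h.mul_dvd_of_dvd_of_dvd (Subgroup.index_dvd_of_le inf_le_left)
      (Subgroup.index_dvd_of_le inf_le_right)

theorem exists_mul_eq_of_coprime_index [Finite G] {x i : G}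
    (h : ((Subgroup.centralizer {x}).index).Coprime (Subgroup.centralizer {i}).index) (g : G) :
    ∃ a b : G, Commute a x ∧ Commute b i ∧ b * a = g := by
  have h1 : (Subgroup.centralizer {i}).relIndex (Subgroup.centralizer {x}) =
      (Subgroup.centralizer {i}).index := by
    have h2 := Subgroup.relIndex_mul_index
      (inf_le_left : Subgroup.centralizer {x} ⊓ Subgroup.centralizer {i} ≤ Subgroup.centralizer {x})
    rw [index_centralizer_inf_of_coprime h, Subgroup.inf_relIndex_left, mul_comm] at h2
    exact Nat.eq_of_mul_eq_mul_left
      (Nat.pos_of_ne_zero Subgroup.index_ne_zero_of_finite) h2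
  have h3 : {y | ∃ a, Commute a x ∧ a⁻¹ * i * a = y} = conjugatesOf i := by
    refine Set.eq_of_subset_of_ncard_le ?_ ?_ (Set.toFinite _)
    · rintro _ ⟨a, -, rfl⟩
      exact isConj_iff.2 ⟨a⁻¹, by rw [inv_inv]⟩
    · rw [ncard_conjugatesOf, ← h1, ← Nat.card_coe_set_eq, Subgroup.relIndex, Subgroup.index]
      refine Nat.card_le_card_of_injective
        (fun q => ⟨(q.out : G) * i * (q.out : G)⁻¹, (q.out : G)⁻¹, ?_, ?_⟩) ?_
      · exact (Commute.inv_left (Subgroup.mem_centralizer_singleton_iff.1 q.out.2))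
      · rw [inv_inv]
      · intro q r hqr
        have h4 : (q.out : G) * i * (q.out : G)⁻¹ = (r.out : G) * i * (r.out : G)⁻¹ :=
          congrArg Subtype.val hqr
        rw [← q.out_eq', ← r.out_eq', QuotientGroup.eq, Subgroup.mem_subgroupOf,
          Subgroup.mem_centralizer_singleton_iff]
        push_cast
        rw [eq_comm, mul_inv_eq_iff_eq_mul] at h4
        rw [mul_assoc, inv_mul_eq_iff_eq_mul, ← mul_assoc, ← mul_assoc, h4]
  have h5 : g⁻¹ * i * g ∈ conjugatesOf i := isConj_iff.2 ⟨g⁻¹, by rw [inv_inv]⟩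
  rw [← h3] at h5
  obtain ⟨a, ha, hi⟩ := h5
  refine ⟨a, g * a⁻¹, ha, ?_, by group⟩
  have : g * (a⁻¹ * i * a) * g⁻¹ = i := by rw [hi]; group
  have h6 : g * a⁻¹ * i * (g * a⁻¹)⁻¹ = i := by
    refine Eq.trans ?_ this
    group
  exact mul_inv_eq_iff_eq_mul.1 h6

theorem exists_conj_pair [Finite G] {x i : G}
    (h : ((Subgroup.centralizer {x}).index).Coprime (Subgroup.centralizer {i}).index) (g k : G) :
    ∃ t, t * x * t⁻¹ = g * x * g⁻¹ ∧ t * i * t⁻¹ = k * i * k⁻¹ := by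
  obtain ⟨a, b, ha, hb, hab⟩ := exists_mul_eq_of_coprime_index h (k⁻¹ * g)
  refine ⟨k * b, ?_, ?_⟩
  · have h1 : k * b = g * a⁻¹ := by rw [eq_mul_inv_iff_mul_eq, mul_assoc, hab]; group
    rw [h1, mul_inv_rev, inv_inv]
    calc g * a⁻¹ * x * (a * g⁻¹) = g * (a⁻¹ * (x * a)) * g⁻¹ := by group
      _ = g * x * g⁻¹ := by rw [← ha.eq]; group
  · calc k * b * i * (k * b)⁻¹ = k * (b * i) * b⁻¹ * k⁻¹ := by group
      _ = k * i * k⁻¹ := by rw [hb.eq]; group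

theorem index_centralizer_mul_dvd [Finite G] {x i : G}
    (h : ((Subgroup.centralizer {x}).index).Coprime (Subgroup.centralizer {i}).index) :
    (Subgroup.centralizer {x * i}).index ∣
      (Subgroup.centralizer {x}).index * (Subgroup.centralizer {i}).index := by
  rw [← index_centralizer_inf_of_coprime h]
  refine Subgroup.index_dvd_of_le fun g hg => ?_
  obtain ⟨h1, h2⟩ := hg
  replace h1 := Subgroup.mem_centralizer_singleton_iff.1 h1
  replace h2 := Subgroup.mem_centralizer_singleton_iff.1 h2
  exact Subgroup.mem_centralizer_singleton_iff.2 (Commute.mul_right (a := g) h1 h2)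

theorem mul_real_of_coprime [Finite G] {x i : G}
    (h : ((Subgroup.centralizer {x}).index).Coprime (Subgroup.centralizer {i}).index)
    (hi : i * i = 1) (hx : ∃ u, u * x * u⁻¹ = x⁻¹) : ∃ u, u * (x * i) * u⁻¹ = (x * i)⁻¹ := by
  obtain ⟨u, hu⟩ := hx
  obtain ⟨t, ht1, ht2⟩ := exists_conj_pair h u 1
  refine ⟨i * t, ?_⟩
  rw [hu] at ht1
  rw [one_mul, inv_one, mul_one] at ht2
  have hi' : i⁻¹ = i := inv_eq_of_mul_eq_one_left hi
  calc i * t * (x * i) * (i * t)⁻¹ = i * (t * x * t⁻¹) * (t * i * t⁻¹) * i⁻¹ := by group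
    _ = (x * i)⁻¹ := by rw [ht1, ht2]; rw [mul_inv_rev, hi', mul_assoc, hi, mul_one]

theorem mul_mem_conjugatesOf [Finite G] {x i k b : G}
    (h : ((Subgroup.centralizer {x}).index).Coprime (Subgroup.centralizer {i}).index)
    (hk : IsConj x k) (hb : IsConj i b) : IsConj (x * i) (k * b) := by
  obtain ⟨g, rfl⟩ := isConj_iff.1 hk
  obtain ⟨g', rfl⟩ := isConj_iff.1 hb
  obtain ⟨t, ht1, ht2⟩ := exists_conj_pair h g g'
  exact isConj_iff.2 ⟨t, by rw [← ht1, ← ht2]; group⟩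

theorem isConj_mul_right_iff [Finite G] {x i k b : G}
    (h : ((Subgroup.centralizer {x}).index).Coprime (Subgroup.centralizer {i}).index)
    (hd : (Subgroup.centralizer {x * i}).index ∣ (Subgroup.centralizer {x}).index)
    (hb : IsConj i b) : IsConj x k ↔ IsConj (x * i) (k * b) := by
  have h1 : (· * b) '' conjugatesOf x = conjugatesOf (x * i) := by
    refine Set.eq_of_subset_of_ncard_le ?_ ?_ (Set.toFinite _)
    · rintro _ ⟨k, hk, rfl⟩
      exact mul_mem_conjugatesOf h hk hb
    · rw [Set.ncard_image_of_injective _ (mul_left_injective b), ncard_conjugatesOf,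
        ncard_conjugatesOf]
      exact Nat.le_of_dvd (Nat.pos_of_ne_zero Subgroup.index_ne_zero_of_finite) hd
  refine ⟨fun hk => mul_mem_conjugatesOf h hk hb, fun hk => ?_⟩
  have h2 : k * b ∈ conjugatesOf (x * i) := hk
  rw [← h1] at h2
  obtain ⟨k', hk', h3⟩ := h2
  rwa [← mul_right_cancel h3]

theorem isConj_mul_left_iff [Finite G] {x i k b : G}
    (h : ((Subgroup.centralizer {x}).index).Coprime (Subgroup.centralizer {i}).index)
    (hd : (Subgroup.centralizer {x * i}).index ∣ (Subgroup.centralizer {i}).index)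
    (hk : IsConj x k) : IsConj i b ↔ IsConj (x * i) (k * b) := by
  have h1 : (k * ·) '' conjugatesOf i = conjugatesOf (x * i) := by
    refine Set.eq_of_subset_of_ncard_le ?_ ?_ (Set.toFinite _)
    · rintro _ ⟨b, hb, rfl⟩
      exact mul_mem_conjugatesOf h hk hb
    · rw [Set.ncard_image_of_injective _ (mul_right_injective k), ncard_conjugatesOf,
        ncard_conjugatesOf]
      exact Nat.le_of_dvd (Nat.pos_of_ne_zero Subgroup.index_ne_zero_of_finite) hd
  refine ⟨fun hb => mul_mem_conjugatesOf h hk hb, fun hb => ?_⟩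
  have h2 : k * b ∈ conjugatesOf (x * i) := hb
  rw [← h1] at h2
  obtain ⟨k', hk', h3⟩ := h2
  rwa [← mul_left_cancel h3]

/-- The stabilizer of a conjugacy class under left multiplication. -/
def classStab (x : G) : Subgroup G where
  carrier := {n | ∀ k, IsConj x k ↔ IsConj x (n * k)}
  one_mem' k := by rw [one_mul]
  mul_mem' {a b} ha hb k := by rw [hb k, ha (b * k), mul_assoc]
  inv_mem' {a} ha k := by rw [ha (a⁻¹ * k), mul_inv_cancel_left]

theorem mem_classStab_iff {x n : G} :
    n ∈ classStab x ↔ ∀ k, IsConj x k ↔ IsConj x (n * k) := Iff.rfl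

theorem mem_classStab_iff_right {x n : G} :
    n ∈ classStab x ↔ ∀ k, IsConj x k ↔ IsConj x (k * n) := by
  have h (k : G) : IsConj x (k * n) ↔ IsConj x (n * k) := by
    have h1 : IsConj (k * n) (n * k) := isConj_iff.2 ⟨n, by group⟩
    exact ⟨fun h => h.trans h1, fun h => h.trans h1.symm⟩
  simp only [h, mem_classStab_iff]

instance classStab_normal (x : G) : (classStab x).Normal where
  conj_mem n hn g k := by
    have h (k : G) : IsConj x (g⁻¹ * k * g) ↔ IsConj x k := by
      have h1 : IsConj (g⁻¹ * k * g) k := isConj_iff.2 ⟨g, by group⟩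
      exact ⟨fun h => h.trans h1, fun h => h.trans h1.symm⟩
    rw [← h k, hn, ← h (g * n * g⁻¹ * k)]
    simp only [← mul_assoc, inv_mul_cancel, one_mul]

theorem mul_mem_classStab [Finite G] {x i b b' : G}
    (h : ((Subgroup.centralizer {x}).index).Coprime (Subgroup.centralizer {i}).index)
    (hd : (Subgroup.centralizer {x * i}).index ∣ (Subgroup.centralizer {x}).index)
    (hi : i * i = 1) (hb : IsConj i b) (hb' : IsConj i b') : b * b' ∈ classStab x := by
  rw [mem_classStab_iff_right]
  intro k
  obtain ⟨g, rfl⟩ := isConj_iff.1 hb'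
  rw [isConj_mul_right_iff h hd hb, isConj_mul_right_iff h hd hb' (k := k * _)]
  rw [mul_assoc k, mul_assoc b, conj_conj_self hi, mul_one]

theorem inv_mul_mem_classStab [Finite G] {x i k k' : G}
    (h : ((Subgroup.centralizer {x}).index).Coprime (Subgroup.centralizer {i}).index)
    (hd : (Subgroup.centralizer {x * i}).index ∣ (Subgroup.centralizer {i}).index)
    (hk : IsConj x k) (hk' : IsConj x k') : k⁻¹ * k' ∈ classStab i := by
  rw [mem_classStab_iff]
  intro b
  rw [isConj_mul_left_iff h hd hk', isConj_mul_left_iff h hd hk (b := _ * b)]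
  rw [mul_assoc, mul_inv_cancel_left]

theorem card_classStab_dvd (x : G) :
    Nat.card (classStab x) ∣ (Subgroup.centralizer {x}).index := by
  rw [← ncard_conjugatesOf, ← Nat.card_coe_set_eq]
  let φ : MulAction (classStab x) (conjugatesOf x) :=
    { smul := fun n k => ⟨(n : G) * k, (n.2 k).1 k.2⟩
      one_smul := fun k => Subtype.ext (one_mul (k : G))
      mul_smul := fun m n k => Subtype.ext (mul_assoc (m : G) n k) }
  have h (k : conjugatesOf x) : MulAction.stabilizer (classStab x) k = ⊥ := by
    rw [eq_bot_iff]
    intro n hn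
    have h1 : (n : G) * k = k := congrArg Subtype.val (MulAction.mem_stabilizer_iff.1 hn)
    exact Subgroup.mem_bot.2 (Subtype.ext (mul_eq_right.1 h1))
  have h1 := Nat.card_congr (MulAction.selfEquivOrbitsQuotientProd (G := classStab x) h)
  rw [Nat.card_prod] at h1
  exact ⟨_, h1.trans (mul_comm _ _)⟩

theorem le_centralizer_of_coprime [Finite G] {y : G} {M : Subgroup G} [M.Normal]
    (h : (Nat.card M).Coprime (Subgroup.centralizer {y}).index) :
    M ≤ Subgroup.centralizer {y} := by
  rw [← Subgroup.relIndex_eq_one]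
  refine Nat.eq_one_of_dvd_coprimes h (Subgroup.relIndex_dvd_card _ _) ?_
  have h1 := Subgroup.relIndex_mul_index (inf_le_left : Subgroup.centralizer {y} ⊓ M ≤ _)
  have h2 := Subgroup.relIndex_mul_index (inf_le_right : Subgroup.centralizer {y} ⊓ M ≤ _)
  have h3 := Subgroup.relIndex_mul_index (le_sup_right : M ≤ Subgroup.centralizer {y} ⊔ M)
  rw [Subgroup.relIndex_sup_right] at h3
  rw [Subgroup.inf_relIndex_left] at h1
  rw [Subgroup.inf_relIndex_right, ← h1, ← h3, mul_left_comm] at h2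
  exact ⟨_, (Nat.eq_of_mul_eq_mul_left
    (Nat.pos_of_ne_zero Subgroup.index_ne_zero_of_finite) h2).symm⟩

theorem classStab_le_centralizer [Finite G] {x y : G}
    (h : ((Subgroup.centralizer {x}).index).Coprime (Subgroup.centralizer {y}).index) :
    classStab x ≤ Subgroup.centralizer {y} :=
  le_centralizer_of_coprime (Nat.Coprime.coprime_dvd_left (card_classStab_dvd x) h)

theorem mul_self_of_real_of_odd [Finite G] {x : G} (hx : ∃ u, u * x * u⁻¹ = x⁻¹)
    (hodd : Odd (Subgroup.centralizer {x}).index) : x * x = 1 := by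
  by_contra hne
  obtain ⟨u, hu⟩ := hx
  rw [← ncard_conjugatesOf, ← Nat.card_coe_set_eq] at hodd
  refine Nat.not_even_iff_odd.2 hodd (even_card_of_involutive
    (f := fun k : conjugatesOf x => ⟨(k : G)⁻¹, ?_⟩) ?_ ?_)
  · obtain ⟨g, hg⟩ := isConj_iff.1 k.2
    exact isConj_iff.2 ⟨g * u, by rw [← hg, ← inv_inv x, ← hu]; rw [← inv_inj]; simp only [mul_inv_rev, inv_inv]; rw [hu]; group⟩
  · intro k
    exact Subtype.ext (inv_inv (k : G))
  · intro k hk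
    have h1 : (k : G)⁻¹ = k := congrArg Subtype.val hk
    obtain ⟨g, hg⟩ := isConj_iff.1 k.2
    have h2 : (k : G) * k = 1 := by rw [← h1]; nth_rw 2 [h1]; exact inv_mul_cancel _
    rw [← hg] at h2
    apply hne
    calc x * x = g⁻¹ * (g * x * g⁻¹ * (g * x * g⁻¹)) * g := by group
      _ = 1 := by rw [h2]; group

end RealClasses

section SplitSizes

variable {G : Type*} [Group G]

/-- All prime divisors of the conjugacy class size of `x` lie in `π`. -/
def SizeIn (π : Set ℕ) (x : G) : Prop :=
  ∀ p : ℕ, p.Prime → p ∣ (Subgroup.centralizer {x}).index → p ∈ π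

/-- Every real class size is a `π₁`-number or a `π₂`-number. -/
structure SplitSizes (G : Type*) [Group G] (π₁ π₂ : Set ℕ) : Prop where
  disjoint : Disjoint π₁ π₂
  two_notMem : 2 ∉ π₂
  split : ∀ x u : G, u * x * u⁻¹ = x⁻¹ → SizeIn π₁ x ∨ SizeIn π₂ x

/-- A product of two conjugates of `i` stabilizes the class of `x`. -/
def StabilizedBy (x i : G) : Prop :=
  ∀ b b', IsConj i b → IsConj i b' → b * b' ∈ classStab x

/-- All conjugates of `i` invert `x`, and quotients of conjugates of `x` stabilize the class
of `i`. -/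
def InvertedBy (x i : G) : Prop :=
  (∀ b, IsConj i b → b * x * b⁻¹ = x⁻¹) ∧ ∀ k k', IsConj x k → IsConj x k' → k⁻¹ * k' ∈ classStab i

theorem exists_conj_ne {x : G} (h : x ∉ Subgroup.center G) : ∃ g, g * x * g⁻¹ ≠ x := by
  by_contra! h1
  exact h (Subgroup.mem_center_iff.2 fun g => mul_inv_eq_iff_eq_mul.1 (h1 g))

theorem eq_of_commute_of_odd {i j : G} (hi : i * i = 1) (hj : j * j = 1) (hc : Commute (i * j) i)
    (hodd : Odd (orderOf (i * j))) : j = i := by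
  have h1 : i * j * i = j := by rw [hc.eq, ← mul_assoc, hi, one_mul]
  have h2 : i * j * (i * j) = 1 := by rw [← mul_assoc, h1, hj]
  have h3 := odd_order_of_mul_self h2 hodd
  calc j = i * (i * j) := by rw [← mul_assoc, hi, one_mul]
    _ = i := by rw [h3, mul_one]

theorem SizeIn.of_isConj {π : Set ℕ} {x y : G} (h : SizeIn π x) (hxy : IsConj x y) :
    SizeIn π y := by
  have h1 : conjugatesOf y = conjugatesOf x := (isConj_iff_conjugatesOf_eq.1 hxy).symm
  intro p hp hd
  rw [← ncard_conjugatesOf, h1, ncard_conjugatesOf] at hd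
  exact h p hp hd

theorem odd_orderOf_of_mem_classStab [Finite G] {x n : G} (hn : n ∈ classStab x)
    (h : Odd (Subgroup.centralizer {x}).index) : Odd (orderOf n) :=
  Odd.of_dvd_nat h (((classStab x).orderOf_dvd_natCard hn).trans (card_classStab_dvd x))

namespace SplitSizes

variable {π₁ π₂ : Set ℕ}

theorem coprime (H : SplitSizes G π₁ π₂) {x i : G} (hx : SizeIn π₁ x) (hi : SizeIn π₂ i) :
    ((Subgroup.centralizer {x}).index).Coprime (Subgroup.centralizer {i}).index :=
  Nat.coprime_of_dvd fun p hp h1 h2 => Set.disjoint_left.1 H.disjoint (hx p hp h1) (hi p hp h2)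

theorem odd (H : SplitSizes G π₁ π₂) {i : G} (hi : SizeIn π₂ i) :
    Odd (Subgroup.centralizer {i}).index := by
  rw [← Nat.not_even_iff_odd, even_iff_two_dvd]
  exact fun h => H.two_notMem (hi 2 Nat.prime_two h)

theorem sizeIn_of_even (H : SplitSizes G π₁ π₂) {x : G} (hr : ∃ u, u * x * u⁻¹ = x⁻¹)
    (he : Even (Subgroup.centralizer {x}).index) : SizeIn π₁ x ∧ x ∉ Subgroup.center G := by
  constructor
  · obtain ⟨u, hu⟩ := hr
    rcases H.split x u hu with h | h
    · exact h
    · exact absurd he (Nat.not_even_iff_odd.2 (H.odd h))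
  · intro h
    have h1 : Subgroup.centralizer {x} = ⊤ := by
      rw [eq_top_iff]
      exact fun g _ => Subgroup.mem_centralizer_singleton_iff.2 (Subgroup.mem_center_iff.1 h g)
    rw [h1, Subgroup.index_top] at he
    exact Nat.not_even_one he

variable [Finite G]

theorem stabilizedBy_or_invertedBy (H : SplitSizes G π₁ π₂) {x i : G}
    (hr : ∃ u, u * x * u⁻¹ = x⁻¹) (hx : SizeIn π₁ x) (hi2 : i * i = 1) (hi : SizeIn π₂ i) :
    StabilizedBy x i ∨ InvertedBy x i := by
  have hc := H.coprime hx hi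
  obtain ⟨u, hu⟩ := mul_real_of_coprime hc hi2 hr
  have hd := index_centralizer_mul_dvd hc
  rcases H.split _ u hu with h | h
  · left
    have hd1 := (H.coprime h hi).dvd_of_dvd_mul_right hd
    exact fun b b' hb hb' => mul_mem_classStab hc hd1 hi2 hb hb'
  · right
    have hd1 := (H.coprime hx h).symm.dvd_of_dvd_mul_left hd
    refine ⟨fun b hb => ?_, fun k k' hk hk' => inv_mul_mem_classStab hc hd1 hk hk'⟩
    have h1 := mul_self_of_real_of_odd ⟨u, hu⟩ (H.odd h)
    obtain ⟨t, ht⟩ := isConj_iff.1 (mul_mem_conjugatesOf hc (IsConj.refl x) hb)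
    have h2 : x * b * (x * b) = 1 := by rw [← ht]; exact conj_conj_self h1
    obtain ⟨g, rfl⟩ := isConj_iff.1 hb
    rw [inv_eq_of_mul_eq_one_left (conj_conj_self (g := g) hi2)]
    rw [mul_assoc] at h2
    rw [mul_assoc]
    exact eq_inv_of_mul_eq_one_right h2

theorem mul_self_of_invertedBy (H : SplitSizes G π₁ π₂) {x i : G} (hx : SizeIn π₁ x)
    (hxc : x ∉ Subgroup.center G) (hi : SizeIn π₂ i) (hA : InvertedBy x i) :
    x * x ≠ 1 ∧ Odd (orderOf (x * x)) := by
  constructor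
  · intro h
    obtain ⟨g, hg⟩ := exists_conj_ne hxc
    have h1 := hA.2 x (g * x * g⁻¹) (IsConj.refl x) (isConj_iff.2 ⟨g, rfl⟩)
    rw [inv_eq_of_mul_eq_one_left h] at h1
    refine hg (eq_of_commute_of_odd h (conj_conj_self h) ?_
      (odd_orderOf_of_mem_classStab h1 (H.odd hi)))
    exact Subgroup.mem_centralizer_singleton_iff.1
      (classStab_le_centralizer (H.coprime hx hi).symm h1)
  · have h1 := hA.2 x⁻¹ x (isConj_iff.2 ⟨i, hA.1 i (IsConj.refl i)⟩) (IsConj.refl x)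
    rw [inv_inv] at h1
    exact odd_orderOf_of_mem_classStab h1 (H.odd hi)

theorem not_stabilizedBy_of_invertedBy (H : SplitSizes G π₁ π₂) {x z i : G} (hx : SizeIn π₁ x)
    (hz : SizeIn π₁ z) (hzc : z ∉ Subgroup.center G) (hi2 : i * i = 1) (hi : SizeIn π₂ i)
    (hA : InvertedBy z i) : ¬ StabilizedBy x i := by
  intro hB
  obtain ⟨h1, h2⟩ := H.mul_self_of_invertedBy hz hzc hi hA
  have h3 := classStab_le_centralizer (H.coprime hx hi)
    (hB i (z * i * z⁻¹) (IsConj.refl i) (isConj_iff.2 ⟨z, rfl⟩))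
  have hi' : i⁻¹ = i := inv_eq_of_mul_eq_one_left hi2
  have h4 : i * z * i⁻¹ = z⁻¹ := hA.1 i (IsConj.refl i)
  have h5 : i * (z * i * z⁻¹) = (z * z)⁻¹ := by
    rw [← mul_assoc, ← mul_assoc]
    nth_rw 2 [← hi']
    rw [h4, mul_inv_rev]
  rw [h5] at h3
  have h6 : Commute (z * z) i :=
    (Commute.inv_left_iff).1 (Subgroup.mem_centralizer_singleton_iff.1 h3)
  have h7 : i * (z * z) * i⁻¹ = (z * z)⁻¹ := by
    rw [mul_inv_rev, ← h4]; group
  rw [← h6.eq, mul_inv_cancel_right] at h7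
  exact h1 (odd_order_of_mul_self (mul_eq_one_iff_eq_inv.2 h7) h2)

theorem even_of_good (H : SplitSizes G π₁ π₂) {x i : G} (hr : ∃ u, u * x * u⁻¹ = x⁻¹)
    (hx : SizeIn π₁ x) (hxc : x ∉ Subgroup.center G) (hi2 : i * i = 1)
    (hic : i ∉ Subgroup.center G) (hi : SizeIn π₂ i) :
    Even (Subgroup.centralizer {x}).index := by
  by_contra hne
  rw [Nat.not_even_iff_odd] at hne
  rcases H.stabilizedBy_or_invertedBy hr hx hi2 hi with h | h
  · obtain ⟨g, hg⟩ := exists_conj_ne hic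
    have h1 := h i (g * i * g⁻¹) (IsConj.refl i) (isConj_iff.2 ⟨g, rfl⟩)
    refine hg (eq_of_commute_of_odd hi2 (conj_conj_self hi2) ?_
      (odd_orderOf_of_mem_classStab h1 hne))
    exact Subgroup.mem_centralizer_singleton_iff.1
      (classStab_le_centralizer (H.coprime hx hi) h1)
  · exact (H.mul_self_of_invertedBy hx hxc hi h).1 (mul_self_of_real_of_odd hr hne)

end SplitSizes

end SplitSizes

section Worlds

variable {G : Type*} [Group G]

/-- A real element of even class size. -/
def RealEven (x : G) : Prop :=
  (∃ u, u * x * u⁻¹ = x⁻¹) ∧ Even (Subgroup.centralizer {x}).index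

theorem real_of_mul_self {x : G} (h : x * x = 1) : ∃ u, u * x * u⁻¹ = x⁻¹ :=
  ⟨1, by rw [one_mul, inv_one, mul_one, inv_eq_of_mul_eq_one_left h]⟩

theorem realEven_of_odd_order [Finite G] {u z : G} (h : u * z * u⁻¹ = z⁻¹)
    (ho : Odd (orderOf z)) (hz : z ≠ 1) : RealEven z := by
  refine ⟨⟨u, h⟩, ?_⟩
  by_contra hne
  exact hz (odd_order_of_mul_self
    (mul_self_of_real_of_odd ⟨u, h⟩ (Nat.not_even_iff_odd.1 hne)) ho)

theorem index_centralizer_of_mem_center {x : G} (h : x ∈ Subgroup.center G) :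
    (Subgroup.centralizer {x}).index = 1 := by
  rw [Subgroup.index_eq_one, eq_top_iff]
  exact fun g _ => Subgroup.mem_centralizer_singleton_iff.2 (Subgroup.mem_center_iff.1 h g)

theorem inverted_inv {b x : G} (h : b * x * b⁻¹ = x⁻¹) : b⁻¹ * x * b⁻¹⁻¹ = x⁻¹ := by
  calc b⁻¹ * x * b⁻¹⁻¹ = b⁻¹ * x⁻¹⁻¹ * b := by rw [inv_inv, inv_inv]
    _ = b⁻¹ * (b * x * b⁻¹)⁻¹ * b := by rw [h]
    _ = x⁻¹ := by group

/-- The subgroup of elements of square one in the center of `M`. -/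
def centralInvolutions (M : Subgroup G) : Subgroup G where
  carrier := {n | n ∈ M ∧ (∀ m ∈ M, Commute n m) ∧ n * n = 1}
  one_mem' := ⟨one_mem M, fun m _ => Commute.one_left m, one_mul 1⟩
  mul_mem' {a b} ha hb := by
    refine ⟨M.mul_mem ha.1 hb.1, fun m hm => (ha.2.1 m hm).mul_left (hb.2.1 m hm), ?_⟩
    rw [(ha.2.1 b hb.1).symm.mul_mul_mul_comm, ha.2.2, hb.2.2, one_mul]
  inv_mem' {a} ha := by
    rw [inv_eq_of_mul_eq_one_left ha.2.2]
    exact ha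

instance centralInvolutions_normal (M : Subgroup G) [hM : M.Normal] :
    (centralInvolutions M).Normal where
  conj_mem n hn g := by
    refine ⟨hM.conj_mem n hn.1 g, fun m hm => ?_, conj_conj_self hn.2.2⟩
    have h1 := hn.2.1 _ (hM.conj_mem m hm g⁻¹)
    have h2 := (Commute.conj_iff g).2 h1
    rwa [inv_inv, show g * (g⁻¹ * m * g) * g⁻¹ = m by group] at h2

namespace SplitSizes

variable {π₁ π₂ : Set ℕ} [Finite G]

theorem exists_of_stabilizedBy (H : SplitSizes G π₁ π₂)
    (hO : ∀ N : Subgroup G, N.Normal → Odd N.index → N = ⊤) {i : G} (hi2 : i * i = 1)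
    (hic : i ∉ Subgroup.center G) (hi : SizeIn π₂ i) {x₀ : G} (hx₀ : RealEven x₀)
    (hB : ∀ x, RealEven x → StabilizedBy x i) :
    ∃ n : G, n * n = 1 ∧ SizeIn π₂ n ∧
      ∀ q : ℕ, q.Prime → q ≠ 2 → q ∣ Nat.card G → q ∣ (Subgroup.centralizer {n}).index := by
  let M : Subgroup G := ⨅ x : {x : G // RealEven x}, classStab (x : G)
  have hM : M.Normal := Subgroup.normal_iInf_normal fun x => classStab_normal _
  have hMx {m x : G} (hm : m ∈ M) (hx : RealEven x) : m ∈ classStab x :=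
    Subgroup.mem_iInf.1 hm ⟨x, hx⟩
  have hMi {m j : G} (hm : m ∈ M) (hj : SizeIn π₂ j) : Commute m j :=
    Subgroup.mem_centralizer_singleton_iff.1 (classStab_le_centralizer
      (H.coprime (H.sizeIn_of_even hx₀.1 hx₀.2).1 hj) (hMx hm hx₀))
  have hNP {n : G} (hn : n ∈ centralInvolutions M) : SizeIn π₂ n := by
    obtain ⟨u, hu⟩ := real_of_mul_self hn.2.2
    have hne : n ≠ 1 → ¬ RealEven n := by
      intro hn1 h
      have h1 := ((hMx hn.1 h) n).1 (IsConj.refl n)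
      rw [hn.2.2] at h1
      exact hn1 (isConj_one_left.1 h1)
    by_cases hnc : n ∈ Subgroup.center G
    · intro p hp hd
      rw [index_centralizer_of_mem_center hnc] at hd
      exact absurd (Nat.dvd_one.1 hd) hp.ne_one
    · rcases H.split n u hu with h | h
      · exact absurd ⟨⟨u, hu⟩, H.even_of_good ⟨u, hu⟩ h hnc hi2 hic hi⟩
          (hne fun h1 => hnc (h1 ▸ Subgroup.one_mem _))
      · exact h
  obtain ⟨g, hg⟩ := exists_conj_ne hic
  have hgi : IsConj i (g * i * g⁻¹) := isConj_iff.2 ⟨g, rfl⟩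
  have hcM : i * (g * i * g⁻¹) ∈ M := Subgroup.mem_iInf.2 fun x =>
    hB x x.2 i (g * i * g⁻¹) (IsConj.refl i) hgi
  have hcN : i * (g * i * g⁻¹) ∈ centralInvolutions M := by
    refine ⟨hcM, fun m hm => ((hMi hm hi).mul_right (hMi hm (hi.of_isConj hgi))).symm, ?_⟩
    have h1 : i * (g * i * g⁻¹) * i = g * i * g⁻¹ := by
      rw [(hMi hcM hi).eq, ← mul_assoc, hi2, one_mul]
    rw [← mul_assoc, h1, conj_conj_self hi2]
  refine ⟨i * (g * i * g⁻¹), hcN.2.2, hNP hcN, fun q hq hq2 hqG => ?_⟩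
  refine dvd_index_centralizer_of_elementary (N := centralInvolutions M) hO
    (fun n hn => hn.2.2) (fun n hn => H.odd (hNP hn)) ?_ ?_ hcN ?_ hq hq2 hqG
  · intro u z hu ho hz n hn g
    have hz' := realEven_of_odd_order hu ho hz
    obtain ⟨t, ht1, ht2⟩ :=
      exists_conj_pair (H.coprime (H.sizeIn_of_even hz'.1 hz'.2).1 (hNP hn)) 1 g
    rw [one_mul, inv_one, mul_one] at ht1
    exact ⟨t, mul_inv_eq_iff_eq_mul.1 ht1, ht2⟩
  · intro u z hu ho hz n hn hc
    have hz' := realEven_of_odd_order hu ho hz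
    obtain ⟨t, ht⟩ := isConj_iff.1 ((hMx hn.1 hz' z).1 (IsConj.refl z))
    have h1 : (n * z) ^ orderOf z = 1 := by
      rw [← ht, conj_pow, pow_orderOf_eq_one, mul_one, mul_inv_cancel]
    rw [hc.symm.mul_pow, pow_orderOf_eq_one, mul_one] at h1
    exact odd_order_of_mul_self hn.2.2 (Odd.of_dvd_nat ho (orderOf_dvd_of_pow_eq_one h1))
  · intro h
    refine hg ?_
    rw [← inv_eq_of_mul_eq_one_right h, inv_eq_of_mul_eq_one_left hi2]

theorem exists_two_pow_of_invertedBy (hO : ∀ N : Subgroup G, N.Normal → Odd N.index → N = ⊤)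
    {i : G} (hA : ∀ x, RealEven x → InvertedBy x i) {x : G} (hx : RealEven x) :
    ∃ k, (Subgroup.centralizer {x}).index = 2 ^ k := by
  have hcore {u y : G} (hu : u * y * u⁻¹ = y⁻¹) (ho : Odd (orderOf y)) :
      y ∈ (Subgroup.centralizer {x}).normalCore := by
    by_cases hy : y = 1
    · rw [hy]
      exact Subgroup.one_mem _
    refine mem_of_pow_mem_of_coprime (m := 2) (n := orderOf y) (Nat.coprime_two_left.2 ho) ?_ ?_
    · rw [← Subgroup.inv_mem_iff]
      intro g
      have h1 : i * y * i⁻¹ = y⁻¹ :=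
        (hA y (realEven_of_odd_order hu ho hy)).1 i (IsConj.refl i)
      have h2 : g * (y ^ 2)⁻¹ * g⁻¹ = g * i * g⁻¹ * (g * y * i⁻¹ * (g * y)⁻¹) := by
        calc g * (y ^ 2)⁻¹ * g⁻¹ = g * y⁻¹ * y⁻¹ * g⁻¹ := by rw [pow_two]; group
          _ = g * (i * y * i⁻¹) * y⁻¹ * g⁻¹ := by rw [h1]
          _ = _ := by group
      rw [h2]
      have hi' : (g * y * i * (g * y)⁻¹)⁻¹ = g * y * i⁻¹ * (g * y)⁻¹ := by group
      have h3 := (hA x hx).1 _ (isConj_iff.2 ⟨g, rfl⟩)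
      have h4 := (hA x hx).1 _ (isConj_iff.2 ⟨g * y, rfl⟩)
      have h5 : (g * y * i * (g * y)⁻¹)⁻¹ * x * (g * y * i * (g * y)⁻¹)⁻¹⁻¹ = x⁻¹ := by
        exact inverted_inv h4
      rw [hi'] at h5
      exact Subgroup.mem_centralizer_singleton_iff.2 (commute_of_inverted_of_inverted h3 h5).eq
    · rw [pow_orderOf_eq_one]
      exact Subgroup.one_mem _
  obtain ⟨T, hT, -, -, ⟨k, hk⟩, hodd, -⟩ := exists_normal_two_power_odd hO
    (C := (Subgroup.centralizer {x}).normalCore) (K := ⊤) inferInstance inferInstance le_top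
    fun u y hu ho _ => hcore hu ho
  rw [Subgroup.relIndex_top_right] at hodd
  rw [hO T hT hodd, Subgroup.relIndex_top_right] at hk
  have h1 : (Subgroup.centralizer {x}).index ∣ 2 ^ k :=
    hk ▸ Subgroup.index_dvd_of_le (Subgroup.normalCore_le _)
  obtain ⟨m, -, hm⟩ := (Nat.dvd_prime_pow Nat.prime_two).1 h1
  exact ⟨m, hm⟩

theorem index_eq_of_invertedBy (H : SplitSizes G π₁ π₂) {x₀ : G} (hx₀ : RealEven x₀)
    (hA : ∀ i : G, i * i = 1 → i ∉ Subgroup.center G → SizeIn π₂ i → InvertedBy x₀ i)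
    {i j : G} (hi2 : i * i = 1) (hic : i ∉ Subgroup.center G) (hi : SizeIn π₂ i)
    (hj2 : j * j = 1) (hjc : j ∉ Subgroup.center G) (hj : SizeIn π₂ j) :
    (Subgroup.centralizer {i}).index = (Subgroup.centralizer {j}).index := by
  have : Fact (Nat.Prime 2) := ⟨Nat.prime_two⟩
  obtain ⟨S, hS⟩ := exists_sylow_le_of_odd_index (H.odd hi)
  obtain ⟨S', hS'⟩ := exists_sylow_le_of_odd_index (H.odd hj)
  obtain ⟨g, rfl⟩ := MulAction.exists_smul_eq G S' S
  have hiS : i ∈ (g • S' : Sylow 2 G) := by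
    have h1 : IsPGroup 2 (Subgroup.zpowers i) := by
      rintro ⟨_, n, rfl⟩
      refine ⟨1, Subtype.ext ?_⟩
      change (i ^ n) ^ 2 ^ 1 = 1
      rw [pow_one, ← zpow_natCast, ← zpow_mul, mul_comm, zpow_mul, zpow_natCast, pow_two, hi2,
        one_zpow]
    have h2 := h1.to_sup_of_normal_left' (g • S' : Sylow 2 G).isPGroup' ?_
    · have h3 := (g • S').is_maximal' h2 le_sup_right
      have h4 : i ∈ Subgroup.zpowers i ⊔ (g • S' : Sylow 2 G).toSubgroup :=
        Subgroup.mem_sup_left (Subgroup.mem_zpowers i)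
      rwa [h3] at h4
    · intro s hs
      refine Subgroup.centralizer_le_normalizer _ ?_
      rw [Subgroup.zpowers_eq_closure, Subgroup.centralizer_closure]
      exact hS hs
  have hjS {s : G} (hs : s ∈ (g • S' : Sylow 2 G)) : Commute s (g * j * g⁻¹) := by
    have h1 : g⁻¹ * s * g ∈ S' := by
      have h2 := Subgroup.mem_pointwise_smul_iff_inv_smul_mem.1 hs
      rw [← map_inv] at h2
      have h3 : g⁻¹ * s * g⁻¹⁻¹ ∈ S' := h2
      rwa [inv_inv] at h3
    have h2 : Commute (g⁻¹ * s * g) j := Subgroup.mem_centralizer_singleton_iff.1 (hS' h1)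
    have h3 := (Commute.conj_iff g).2 h2
    rwa [show g * (g⁻¹ * s * g) * g⁻¹ = s by group] at h3
  have hij := hjS hiS
  have hw2 : i * (g * j * g⁻¹) * (i * (g * j * g⁻¹)) = 1 := by
    rw [hij.symm.mul_mul_mul_comm, hi2, conj_conj_self hj2, one_mul]
  have hgj : IsConj j (g * j * g⁻¹) := isConj_iff.2 ⟨g, rfl⟩
  have hodd : Odd (Subgroup.centralizer {i * (g * j * g⁻¹)}).index := by
    refine Odd.of_dvd_nat (Sylow.odd_index (g • S')) (Subgroup.index_dvd_of_le fun s hs => ?_)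
    exact Subgroup.mem_centralizer_singleton_iff.2
      (Commute.mul_right (Subgroup.mem_centralizer_singleton_iff.1 (hS hs)) (hjS hs)).eq
  have hgji : (Subgroup.centralizer {g * j * g⁻¹}).index = (Subgroup.centralizer {j}).index := by
    rw [← ncard_conjugatesOf, ← ncard_conjugatesOf, isConj_iff_conjugatesOf_eq.1 hgj]
  by_cases hwc : i * (g * j * g⁻¹) ∈ Subgroup.center G
  · rw [← hgji]
    congr 1
    ext t
    have h1 : Commute t (i * (g * j * g⁻¹)) := Subgroup.mem_center_iff.1 hwc t
    rw [Subgroup.mem_centralizer_singleton_iff, Subgroup.mem_centralizer_singleton_iff]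
    refine ⟨fun h => ?_, fun h => ?_⟩
    · have h2 := Commute.mul_right (a := t) h h1
      rw [← mul_assoc, hi2, one_mul] at h2
      exact h2
    · have h2 := h1.mul_right h
      rw [mul_assoc, conj_conj_self hj2, mul_one] at h2
      exact h2
  · obtain ⟨u, hu⟩ := real_of_mul_self hw2
    rcases H.split _ u hu with h | h
    · exact absurd (H.even_of_good ⟨u, hu⟩ h hwc hi2 hic hi) (Nat.not_even_iff_odd.2 hodd)
    · have h1 := (hA _ hw2 hwc h).1 _ (IsConj.refl _)
      have h2 := commute_of_inverted_of_inverted ((hA i hi2 hic hi).1 i (IsConj.refl i))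
        ((hA j hj2 hjc hj).1 _ hgj)
      rw [h2.eq, mul_inv_cancel_right] at h1
      have h3 := H.sizeIn_of_even hx₀.1 hx₀.2
      exact absurd (mul_eq_one_iff_eq_inv.2 h1)
        (H.mul_self_of_invertedBy h3.1 h3.2 hi (hA i hi2 hic hi)).1

end SplitSizes

end Worlds

section RealGraph

variable {G : Type*} [Group G]

theorem clSize_eq_index (x : G) : clSize G x = (Subgroup.centralizer {x}).index := by
  rw [← ncard_conjugatesOf, ← Nat.card_coe_set_eq]
  rfl

theorem isRealEl_iff {x : G} : IsRealEl G x ↔ ∃ u, u * x * u⁻¹ = x⁻¹ :=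
  ⟨fun ⟨g, hg⟩ => ⟨g⁻¹, by rwa [inv_inv]⟩, fun ⟨u, hu⟩ => ⟨u⁻¹, by rwa [inv_inv]⟩⟩

theorem splitSizes_of_realAdj {π₁ π₂ : Set ℕ} (hdisj : Disjoint π₁ π₂)
    (hcover : π₁ ∪ π₂ = realVerts G) (hnoedge : ∀ p ∈ π₁, ∀ q ∈ π₂, ¬ realAdj G p q)
    (h2not : 2 ∉ π₂) : SplitSizes G π₁ π₂ := by
  refine ⟨hdisj, h2not, fun x u hu => ?_⟩
  have hx : IsRealEl G x := isRealEl_iff.2 ⟨u, hu⟩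
  have hmem (p : ℕ) (hp : p.Prime) (hd : p ∣ (Subgroup.centralizer {x}).index) :
      p ∈ π₁ ∪ π₂ := by
    rw [hcover]
    exact ⟨hp, x, hx, by rwa [clSize_eq_index]⟩
  by_contra! hne
  obtain ⟨h1, h2⟩ := hne
  simp only [SizeIn, not_forall] at h1 h2
  obtain ⟨q, hq, hqd, hq1⟩ := h1
  obtain ⟨p, hp, hpd, hp2⟩ := h2
  have hq2 : q ∈ π₂ := (hmem q hq hqd).resolve_left hq1
  have hp1 : p ∈ π₁ := (hmem p hp hpd).resolve_right hp2
  have hne : p ≠ q := fun h => hp2 (h ▸ hq2)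
  refine hnoedge p hp1 q hq2 ⟨hp, hq, hne, x, hx, ?_⟩
  rw [clSize_eq_index]
  exact ((Nat.coprime_primes hp hq).2 hne).mul_dvd_of_dvd_of_dvd hpd hqd

end RealGraph

theorem stmt_17 {G : Type*} [Group G] [Finite G]
    (hO : ∀ N : Subgroup G, N.Normal → Odd N.index → N = ⊤)
    (π₁ π₂ : Set ℕ) (h1 : π₁.Nonempty) (h2 : π₂.Nonempty) (hdisj : Disjoint π₁ π₂)
    (hcover : π₁ ∪ π₂ = realVerts G)
    (hnoedge : ∀ p ∈ π₁, ∀ q ∈ π₂, ¬ realAdj G p q)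
    (h2in : 2 ∈ π₁) (h2not : 2 ∉ π₂) :
    π₁ = {2} ∧
      (∃ i : G, i ^ 2 = 1 ∧ i ≠ 1 ∧ i ∉ Subgroup.center G ∧
        π₂ = {p : ℕ | p.Prime ∧ p ∣ clSize G i}) ∧
      ∀ x : G, IsRealEl G x → Odd (clSize G x) ∨ ∃ k : ℕ, clSize G x = 2 ^ k := by
  have H := splitSizes_of_realAdj hdisj hcover hnoedge h2not
  have hvert {p : ℕ} (hp : p ∈ π₁ ∪ π₂) : p.Prime ∧ ∃ x : G, (∃ u, u * x * u⁻¹ = x⁻¹) ∧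
      p ∣ (Subgroup.centralizer {x}).index := by
    rw [hcover] at hp
    obtain ⟨hp, x, hx, hd⟩ := hp
    exact ⟨hp, x, isRealEl_iff.1 hx, by rwa [← clSize_eq_index]⟩
  have hsize {p : ℕ} {x : G} (hp : p.Prime) (hd : p ∣ (Subgroup.centralizer {x}).index) :
      x ∉ Subgroup.center G := by
    intro h
    rw [index_centralizer_of_mem_center h] at hd
    exact hp.ne_one (Nat.dvd_one.1 hd)
  obtain ⟨-, x₀, hr₀, hd₀⟩ := hvert (Or.inl h2in)
  have hx₀ : RealEven x₀ := ⟨hr₀, even_iff_two_dvd.2 hd₀⟩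
  have hgood {q : ℕ} (hq : q ∈ π₂) : ∃ i : G, i * i = 1 ∧ i ∉ Subgroup.center G ∧ SizeIn π₂ i ∧
      q ∣ (Subgroup.centralizer {i}).index := by
    obtain ⟨hqp, x, ⟨u, hu⟩, hd⟩ := hvert (Or.inr hq)
    rcases H.split x u hu with h | h
    · exact absurd hq (Set.disjoint_left.1 hdisj (h q hqp hd))
    · exact ⟨x, mul_self_of_real_of_odd ⟨u, hu⟩ (H.odd h), hsize hqp hd, h, hd⟩
  have hfirst : π₁ = {2} ∧ ∃ i : G, i * i = 1 ∧ i ∉ Subgroup.center G ∧ SizeIn π₂ i ∧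
      ∀ q ∈ π₂, q ∣ (Subgroup.centralizer {i}).index := by
    by_cases hB : ∃ i : G, i * i = 1 ∧ i ∉ Subgroup.center G ∧ SizeIn π₂ i ∧
        ∀ x, RealEven x → StabilizedBy x i
    · obtain ⟨i, hi2, hic, hi, hBi⟩ := hB
      obtain ⟨n, hn2, hn, hdvd⟩ := H.exists_of_stabilizedBy hO hi2 hic hi hx₀ hBi
      have hq {q : ℕ} (hq : q ∈ π₁ ∪ π₂) (hq2 : q ≠ 2) :
          q.Prime ∧ q ∣ (Subgroup.centralizer {n}).index := by
        obtain ⟨hqp, x, -, hd⟩ := hvert hq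
        exact ⟨hqp, hdvd q hqp hq2 (hd.trans (Subgroup.index_dvd_card _))⟩
      have hq' (q : ℕ) (hq2 : q ∈ π₂) := hq (Or.inr hq2) fun h => h2not (h ▸ hq2)
      obtain ⟨q, hq₀⟩ := h2
      refine ⟨Set.eq_singleton_iff_unique_mem.2 ⟨h2in, fun p hp => ?_⟩,
        n, hn2, hsize (hq' q hq₀).1 (hq' q hq₀).2, hn, fun q hq2 => (hq' q hq2).2⟩
      by_contra hp2
      obtain ⟨hpp, hpd⟩ := hq (Or.inl hp) hp2
      exact Set.disjoint_left.1 hdisj hp (hn p hpp hpd)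
    · push Not at hB
      have hA (i : G) (hi2 : i * i = 1) (hic : i ∉ Subgroup.center G) (hi : SizeIn π₂ i) (x : G)
          (hx : RealEven x) : InvertedBy x i := by
        obtain ⟨z, hz, hzn⟩ := hB i hi2 hic hi
        have hz' := H.sizeIn_of_even hz.1 hz.2
        have hx' := H.sizeIn_of_even hx.1 hx.2
        have hzA := (H.stabilizedBy_or_invertedBy hz.1 hz'.1 hi2 hi).resolve_left hzn
        exact (H.stabilizedBy_or_invertedBy hx.1 hx'.1 hi2 hi).resolve_left
          (H.not_stabilizedBy_of_invertedBy hx'.1 hz'.1 hz'.2 hi2 hi hzA)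
      obtain ⟨q, hq⟩ := h2
      obtain ⟨i, hi2, hic, hi, -⟩ := hgood hq
      refine ⟨Set.eq_singleton_iff_unique_mem.2 ⟨h2in, fun p hp => ?_⟩, i, hi2, hic, hi,
        fun q hq => ?_⟩
      · obtain ⟨hpp, x, hr, hd⟩ := hvert (Or.inl hp)
        obtain ⟨u, hu⟩ := hr
        have hxP : SizeIn π₁ x := (H.split x u hu).resolve_right fun h =>
          Set.disjoint_left.1 hdisj hp (h p hpp hd)
        have hx : RealEven x := ⟨⟨u, hu⟩, H.even_of_good ⟨u, hu⟩ hxP (hsize hpp hd) hi2 hic hi⟩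
        obtain ⟨k, hk⟩ := SplitSizes.exists_two_pow_of_invertedBy hO (hA i hi2 hic hi) hx
        rw [hk] at hd
        exact (Nat.prime_dvd_prime_iff_eq hpp Nat.prime_two).1 (hpp.dvd_of_dvd_pow hd)
      · obtain ⟨j, hj2, hjc, hj, hd⟩ := hgood hq
        rwa [H.index_eq_of_invertedBy hx₀ (fun i h2 hc h => hA i h2 hc h x₀ hx₀) hi2 hic hi hj2
          hjc hj]
  obtain ⟨hπ₁, i, hi2, hic, hi, hid⟩ := hfirst
  refine ⟨hπ₁, ⟨i, by rw [pow_two, hi2], fun h => hic (h ▸ Subgroup.one_mem _), hic, ?_⟩,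
    fun x hx => ?_⟩
  · ext q
    rw [Set.mem_ofPred_eq, clSize_eq_index]
    exact ⟨fun hq => ⟨(hvert (Or.inr hq)).1, hid q hq⟩, fun hq => hi q hq.1 hq.2⟩
  · rw [clSize_eq_index]
    obtain ⟨u, hu⟩ := isRealEl_iff.1 hx
    rcases H.split x u hu with h | h
    · right
      refine ⟨_, Nat.eq_prime_pow_of_unique_prime_dvd (p := 2) Subgroup.index_ne_zero_of_finite
        fun {p} hp hd => ?_⟩
      have := h p hp hd
      rwa [hπ₁] at this
    · exact Or.inl (H.odd h)
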